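/- arXiv:math/0508361 — 2 statements merged into one kernel-verified Lean document; each statement's English description precedes it below -/
import Mathlib

section
/- Let f* be a multiplicative function with -1 ≤ f*(n) ≤ 1 for all positive integers n, let f be the completely multiplicative function with f(p) = f*(p) for every prime p, and let h be the multiplicative function determined by h(p^k) = f*(p^k) − f*(p) f*(p^{k−1}) for k ≥ 1. Then the series H₀ = ∑_{d=1}^{∞} h(d)/d and H₁ = −∑_{d=1}^{∞} h(d) log d / d converge absolutely, H₀ ≥ 0, and there exist absolute constants C and x₀ (independent of f*) such that for all real x ≥ x₀, | ∑_{n ≤ x} f*(n)/n − H₀ ∑_{n ≤ x} f(n)/n − H₁ · (1/x) ∑_{n ≤ x} f(n) | ≤ C/(log x)^{1/5}. -/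
/-- A completely multiplicative function `f : ℕ → ℝ` (on positive integers):
`f 1 = 1` and `f (m * n) = f m * f n` for all positive `m, n`. -/
def IsComplMult (f : ℕ → ℝ) : Prop :=
  f 1 = 1 ∧ ∀ m n : ℕ, 0 < m → 0 < n → f (m * n) = f m * f n

/-- A multiplicative function `f : ℕ → ℝ`: `f 1 = 1` and `f (m * n) = f m * f n`
whenever `m` and `n` are coprime. -/
def IsMult (f : ℕ → ℝ) : Prop :=
  f 1 = 1 ∧ ∀ m n : ℕ, Nat.Coprime m n → f (m * n) = f m * f n

open MeasureTheory FourierTransform in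
theorem fourier_lp_ae_eq {f : ℝ → ℂ} (h₁ : Integrable f) (h₂ : MemLp f 2) :
    ((𝓕 (h₂.toLp f) : Lp ℂ 2 (volume : Measure ℝ)) : ℝ → ℂ) =ᵐ[volume] 𝓕 f := by
  have hcont : Continuous (𝓕 f) :=
    VectorFourier.fourierIntegral_continuous Real.continuous_fourierChar continuous_inner h₁
  apply ae_eq_of_integral_contDiff_smul_eq
  · exact (Lp.memLp _).locallyIntegrable (by norm_num)
  · exact hcont.locallyIntegrable
  intro g g_smooth g_cpt
  have hg₁ : HasCompactSupport (Complex.ofRealCLM ∘ g) := g_cpt.comp_left rfl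
  have hg₂ : ContDiff ℝ ((⊤ : ℕ∞) : WithTop ℕ∞) (Complex.ofRealCLM ∘ g) := by fun_prop
  set φ : SchwartzMap ℝ ℂ := hg₁.toSchwartzMap hg₂ with hφ
  have h3 := congrArg (fun T => T φ) (Lp.fourier_toTemperedDistribution_eq (h₂.toLp f))
  simp only [TemperedDistribution.fourier_apply, Lp.toTemperedDistribution_apply] at h3
  have h4 : ∫ x, (𝓕 φ) x • (h₂.toLp f : ℝ → ℂ) x = ∫ x, (𝓕 φ) x • f x := by
    apply integral_congr_ae
    filter_upwards [h₂.coeFn_toLp] with x hx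
    rw [hx]
  rw [h4] at h3
  have h5 : ∫ x, (𝓕 φ) x • f x = ∫ x, φ x • 𝓕 f x := by
    have := VectorFourier.integral_fourierIntegral_smul_eq_flip (L := innerₗ ℝ)
      Real.continuous_fourierChar continuous_inner (φ.integrable (μ := volume)) h₁
    simpa using! this
  rw [h5] at h3
  simpa [φ] using! h3.symm

open MeasureTheory FourierTransform in
/-- Plancherel's theorem for the Fourier integral of functions in `L¹ ∩ L²`. -/
theorem plancherel_integral {f : ℝ → ℂ} (h₁ : Integrable f) (h₂ : MemLp f 2) :
    Integrable (fun y => ‖𝓕 f y‖ ^ 2) ∧ ∫ y, ‖𝓕 f y‖ ^ 2 = ∫ x, ‖f x‖ ^ 2 := by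
  have hae := fourier_lp_ae_eq h₁ h₂
  have key : ∀ u : Lp ℂ 2 (volume : Measure ℝ), ‖u‖ ^ 2 = ∫ x, ‖u x‖ ^ 2 := by
    intro u
    have := L2.inner_def (𝕜 := ℂ) u u
    rw [inner_self_eq_norm_sq_to_K] at this
    have h2 : ∫ x, inner ℂ (u x) (u x) = ((∫ x, ‖u x‖ ^ 2 : ℝ) : ℂ) := by
      rw [← integral_complex_ofReal]
      congr with x
      rw [inner_self_eq_norm_sq_to_K]; norm_cast
    rw [h2] at this
    rw [← Complex.ofReal_inj, ← this]; simp
  constructor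
  · have : MemLp (𝓕 f) 2 := (memLp_congr_ae hae).1 (Lp.memLp _)
    exact this.integrable_norm_pow (by norm_num)
  · have e1 : ∫ y, ‖𝓕 f y‖ ^ 2 = ‖(𝓕 (h₂.toLp f) : Lp ℂ 2 (volume : Measure ℝ))‖ ^ 2 := by
      rw [key]
      apply integral_congr_ae
      filter_upwards [hae] with x hx
      rw [hx]
    rw [e1, Lp.norm_fourier_eq, key]
    apply integral_congr_ae
    filter_upwards [h₂.coeFn_toLp] with x hx
    rw [hx]

theorem abs_cos_le_trig (θ : ℝ) :
    |Real.cos θ| ≤ 0.698 + 0.354 * Real.cos (2 * θ) + 0.01 * Real.cos (8 * θ) := by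
  have h2 : Real.cos (2 * θ) = 2 * |Real.cos θ| ^ 2 - 1 := by
    rw [Real.cos_two_mul, sq_abs]
  have h4 : Real.cos (4 * θ) = 2 * Real.cos (2 * θ) ^ 2 - 1 := by
    rw [← Real.cos_two_mul]; ring_nf
  have h8 : Real.cos (8 * θ) = 2 * Real.cos (4 * θ) ^ 2 - 1 := by
    rw [← Real.cos_two_mul]; ring_nf
  have hv0 : 0 ≤ |Real.cos θ| := abs_nonneg _
  have hv1 : |Real.cos θ| ≤ 1 := Real.abs_cos_le_one θ
  rw [h8, h4, h2]
  generalize |Real.cos θ| = v at *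
  have hW : 0 ≤ 0.7065 - 0.32 * (v + 0.7071) ^ 2 * (4 * v ^ 2 * (1 - v ^ 2)) := by
    nlinarith [mul_nonneg hv0 (sub_nonneg.2 hv1), sq_nonneg (v ^ 2 - 0.64), sq_nonneg (v - 0.8),
      sq_nonneg (v ^ 3 + 0.5 * v ^ 2 - 0.832), sq_nonneg (v * (v - 0.8)),
      mul_nonneg hv0 (sq_nonneg (v - 0.8)), mul_nonneg hv0 (sq_nonneg (v * (v - 0.8)))]
  nlinarith [mul_nonneg hW (sq_nonneg (v - 0.7071))]

open Complex in
theorem norm_cpow_sub_telescope_le {s : ℂ} (hs : 1 < s.re) {n : ℕ} (hn : 1 ≤ n) :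
    ‖(n : ℂ) ^ (-s) - ((n : ℂ) ^ (1 - s) - ((n + 1 : ℕ) : ℂ) ^ (1 - s)) / (s - 1)‖
      ≤ ‖s‖ * ((n : ℝ) ^ 2)⁻¹ := by
  have hn0 : (0 : ℝ) < n := by exact_mod_cast hn
  have hn1 : (1 : ℝ) ≤ n := by exact_mod_cast hn
  have hs0 : s ≠ 0 := by rintro rfl; simp at hs; linarith
  have hs1 : s - 1 ≠ 0 := by
    intro h; rw [sub_eq_zero] at h; rw [h] at hs; simp at hs
  have hs1' : 1 - s ≠ 0 := by
    intro h; apply hs1; rw [← neg_sub, h, neg_zero]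
  have step1 : ∀ u ∈ Set.Icc (n : ℝ) (n + 1),
      ‖(u : ℂ) ^ (-s) - ((n : ℝ) : ℂ) ^ (-s)‖ ≤ ‖s‖ * ((n : ℝ) ^ 2)⁻¹ := by
    intro u hu
    have := Convex.norm_image_sub_le_of_norm_hasDerivWithin_le (𝕜 := ℝ)
      (f := fun u : ℝ => (u : ℂ) ^ (-s)) (f' := fun u : ℝ => (-s) * (u : ℂ) ^ (-s - 1))
      (s := Set.Icc (n : ℝ) (n + 1)) (x := n) (y := u) (C := ‖s‖ * ((n : ℝ) ^ 2)⁻¹) ?_ ?_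
      (convex_Icc _ _) ⟨le_rfl, by linarith⟩ hu
    · refine this.trans ?_
      rw [Real.norm_eq_abs, abs_of_nonneg (by linarith [hu.1])]
      have : u - n ≤ 1 := by linarith [hu.2]
      exact mul_le_of_le_one_right (by positivity) this
    · intro x hx
      have hx0 : 0 < x := lt_of_lt_of_le hn0 hx.1
      have h' := hasDerivAt_ofReal_cpow_const (x := x) (r := -s) hx0.ne' (neg_ne_zero.2 hs0)
      exact h'.hasDerivWithinAt
    · intro x hx
      have hx0 : 0 < x := lt_of_lt_of_le hn0 hx.1
      rw [norm_mul, norm_neg, norm_cpow_eq_rpow_re_of_pos hx0]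
      gcongr
      simp only [sub_re, neg_re, one_re]
      calc x ^ (-s.re - 1) ≤ (n : ℝ) ^ (-s.re - 1) :=
            Real.rpow_le_rpow_of_nonpos hn0 hx.1 (by linarith)
        _ ≤ (n : ℝ) ^ (-2 : ℝ) := Real.rpow_le_rpow_of_exponent_le hn1 (by linarith)
        _ = _ := by rw [Real.rpow_neg hn0.le]; norm_cast
  have := Convex.norm_image_sub_le_of_norm_hasDerivWithin_le (𝕜 := ℝ)
      (f := fun u : ℝ => (u : ℂ) ^ (1 - s) / (1 - s) - u * ((n : ℝ) : ℂ) ^ (-s))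
      (f' := fun u : ℝ => (u : ℂ) ^ (-s) - ((n : ℝ) : ℂ) ^ (-s))
      (s := Set.Icc (n : ℝ) (n + 1)) (x := n) (y := n + 1) (C := ‖s‖ * ((n : ℝ) ^ 2)⁻¹) ?_ step1
      (convex_Icc _ _) ⟨le_rfl, by linarith⟩ ⟨by linarith, le_rfl⟩
  · rw [add_sub_cancel_left, norm_one, mul_one] at this
    rw [← norm_neg]
    convert! this using 2
    push_cast
    field_simp
    ring
  · intro x hx
    have hx0 : 0 < x := lt_of_lt_of_le hn0 hx.1
    have h := (hasDerivAt_ofReal_cpow_const (x := x) (r := 1 - s) hx0.ne' hs1').div_const (1 - s)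
    rw [mul_div_cancel_left₀ _ hs1', show 1 - s - 1 = -s by ring] at h
    have h2 : HasDerivAt (fun u : ℝ => (u : ℂ) * ((n : ℝ) : ℂ) ^ (-s))
        (((n : ℝ) : ℂ) ^ (-s)) x := by
      simpa using (Complex.ofRealCLM.hasDerivAt (x := x)).mul_const (((n : ℝ) : ℂ) ^ (-s))
    exact (h.sub h2).hasDerivWithinAt

theorem sum_Ico_inv_sq_le (a : ℕ) (ha : 1 ≤ a) (b : ℕ) :
    ∑ n ∈ Finset.Ico a b, ((n : ℝ) ^ 2)⁻¹ ≤ 2 / a := by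
  have := sum_Ioo_inv_sq_le (α := ℝ) (a - 1) b
  have e : Finset.Ico a b = Finset.Ioo (a - 1) b := by
    ext x; simp only [Finset.mem_Ico, Finset.mem_Ioo]; omega
  rw [e]
  refine this.trans (le_of_eq ?_)
  congr 1
  have : ((a - 1 : ℕ) : ℝ) = a - 1 := by rw [Nat.cast_sub ha]; simp
  rw [this]; ring

open Complex Filter Topology in
theorem norm_zeta_le_truncated {s : ℂ} (hs : 1 < s.re) {N : ℕ} (hN : 1 ≤ N) :
    ‖riemannZeta s‖ ≤ (1 + Real.log N) + 1 / ‖s - 1‖ + ‖s‖ * (2 / N) := by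
  have hpos : 0 < s.re := by linarith
  have hs0 : s ≠ 0 := by rintro rfl; simp at hs; linarith
  have hs1 : s - 1 ≠ 0 := by
    intro h; rw [sub_eq_zero] at h; rw [h] at hs; simp at hs
  have hsum : HasSum (fun n : ℕ => (n : ℂ) ^ (-s)) (riemannZeta s) := by
    have h1 := zeta_eq_tsum_one_div_nat_cpow hs
    have h2 : Summable (fun n : ℕ => 1 / (n : ℂ) ^ s) := summable_one_div_nat_cpow.2 hs
    have := h2.hasSum
    rw [← h1] at this
    convert! this using 2 with n
    rw [cpow_neg, one_div]
  have hlim := hsum.tendsto_sum_nat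
  have hbound : ∀ M ≥ N, ‖∑ n ∈ Finset.range M, (n : ℂ) ^ (-s)‖ ≤
      (1 + Real.log N) + 1 / ‖s - 1‖ + ‖s‖ * (2 / N) + ‖(M : ℂ) ^ (1 - s)‖ / ‖s - 1‖ := by
    intro M hM
    have htel : ∑ n ∈ Finset.Ico N M, ((n : ℂ) ^ (1 - s) - ((n + 1 : ℕ) : ℂ) ^ (1 - s))
        = (N : ℂ) ^ (1 - s) - (M : ℂ) ^ (1 - s) := by
      rw [← neg_inj, ← Finset.sum_neg_distrib, neg_sub]
      simp_rw [neg_sub]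
      exact Finset.sum_Ico_sub (fun n : ℕ => (n : ℂ) ^ (1 - s)) hM
    have hsplit : ∑ n ∈ Finset.range M, (n : ℂ) ^ (-s) =
        ∑ n ∈ Finset.range N, (n : ℂ) ^ (-s) + ∑ n ∈ Finset.Ico N M,
          ((n : ℂ) ^ (-s) - ((n : ℂ) ^ (1 - s) - ((n + 1 : ℕ) : ℂ) ^ (1 - s)) / (s - 1))
        + ((N : ℂ) ^ (1 - s) - (M : ℂ) ^ (1 - s)) / (s - 1) := by
      rw [Finset.sum_sub_distrib, ← Finset.sum_div,
        htel, add_assoc,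
        sub_add_cancel, Finset.sum_range_add_sum_Ico _ hM]
    rw [hsplit]
    have h1 : ‖∑ n ∈ Finset.range N, (n : ℂ) ^ (-s)‖ ≤ 1 + Real.log N := by
      calc _ ≤ ∑ n ∈ Finset.range N, ‖(n : ℂ) ^ (-s)‖ := norm_sum_le _ _
        _ ≤ ∑ n ∈ Finset.range N, ((n : ℝ))⁻¹ := by
          apply Finset.sum_le_sum
          intro n _
          rcases Nat.eq_zero_or_pos n with rfl | hn
          · simp [hs0]
          · rw [norm_natCast_cpow_of_pos hn, ← Real.rpow_neg_one]
            apply Real.rpow_le_rpow_of_exponent_le (by exact_mod_cast hn)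
            simp only [neg_re]; linarith
        _ ≤ ∑ n ∈ Finset.Icc 1 N, ((n : ℝ))⁻¹ := by
          rw [← Finset.sum_filter_add_sum_filter_not (Finset.range N) (fun n => n = 0)]
          rw [Finset.sum_eq_zero (s := (Finset.range N).filter (fun n => n = 0))]
          · rw [zero_add]
            apply Finset.sum_le_sum_of_subset_of_nonneg
            · intro x; simp only [Finset.mem_filter, Finset.mem_range, Finset.mem_Icc]; omega
            · intros; positivity
          · intro x hx
            rw [(Finset.mem_filter.1 hx).2]; simp
        _ ≤ 1 + Real.log N := by
          have := harmonic_le_one_add_log N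
          rw [harmonic_eq_sum_Icc] at this
          push_cast at this
          exact this
    have h2 : ‖∑ n ∈ Finset.Ico N M,
          ((n : ℂ) ^ (-s) - ((n : ℂ) ^ (1 - s) - ((n + 1 : ℕ) : ℂ) ^ (1 - s)) / (s - 1))‖
          ≤ ‖s‖ * (2 / N) := by
      refine (norm_sum_le _ _).trans ?_
      calc _ ≤ ∑ n ∈ Finset.Ico N M, ‖s‖ * ((n : ℝ) ^ 2)⁻¹ := by
            apply Finset.sum_le_sum
            intro n hn
            exact norm_cpow_sub_telescope_le hs (hN.trans (Finset.mem_Ico.1 hn).1)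
        _ ≤ _ := by
          rw [← Finset.mul_sum]
          gcongr
          exact sum_Ico_inv_sq_le N hN M
    have h3 : ‖((N : ℂ) ^ (1 - s) - (M : ℂ) ^ (1 - s)) / (s - 1)‖
        ≤ 1 / ‖s - 1‖ + ‖(M : ℂ) ^ (1 - s)‖ / ‖s - 1‖ := by
      rw [norm_div, ← add_div]
      gcongr
      refine (norm_sub_le _ _).trans ?_
      gcongr
      rw [norm_natCast_cpow_of_pos (by omega)]
      apply Real.rpow_le_one_of_one_le_of_nonpos (by exact_mod_cast hN)
      simp only [sub_re, one_re]; linarith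
    refine (norm_add₃_le).trans ?_
    linarith
  have hlim2 : Tendsto (fun M : ℕ => (1 + Real.log N) + 1 / ‖s - 1‖ + ‖s‖ * (2 / N)
      + ‖(M : ℂ) ^ (1 - s)‖ / ‖s - 1‖) atTop
      (𝓝 ((1 + Real.log N) + 1 / ‖s - 1‖ + ‖s‖ * (2 / N) + 0 / ‖s - 1‖)) := by
    apply Tendsto.const_add
    apply Tendsto.div_const
    have : Tendsto (fun M : ℕ => (M : ℝ) ^ (-(s.re - 1))) atTop (𝓝 0) :=
      (tendsto_rpow_neg_atTop (by linarith)).comp tendsto_natCast_atTop_atTop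
    refine this.congr' ?_
    filter_upwards [eventually_ge_atTop 1] with M hM
    rw [norm_natCast_cpow_of_pos hM]
    simp
  have := le_of_tendsto_of_tendsto hlim.norm hlim2 ?_
  · simpa using this
  · filter_upwards [eventually_ge_atTop N] with M hM using hbound M hM

theorem exists_norm_zeta_le {ε : ℝ} (hε : 0 < ε) :
    ∃ C : ℝ, 1 ≤ C ∧ ∀ α t : ℝ, 0 < α → α ≤ 1 →
      ‖riemannZeta (1 + α + t * Complex.I)‖ ≤
        C * (1 / ‖(α : ℂ) + t * Complex.I‖ + (1 + |t|) ^ ε) := by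
  refine ⟨10 + (1 / ε) * 3 ^ ε, ?_, ?_⟩
  · have : (0 : ℝ) ≤ (1 / ε) * 3 ^ ε := by positivity
    linarith
  intro α t hα hα1
  set s : ℂ := 1 + α + t * Complex.I with hs
  have hre : s.re = 1 + α := by simp [hs]
  have h1 : s - 1 = α + t * Complex.I := by rw [hs]; ring
  set N : ℕ := ⌈|t|⌉₊ + 1 with hN
  have ht := abs_nonneg t
  have hN1 : |t| ≤ N - 1 := by
    have := Nat.le_ceil |t|; rw [hN]; push_cast; linarith
  have hN2 : (N : ℝ) ≤ 3 * (1 + |t|) := by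
    have := Nat.ceil_lt_add_one ht; rw [hN]; push_cast; linarith
  have hNpos : (1 : ℝ) ≤ N := by linarith
  have := norm_zeta_le_truncated (s := s) (by rw [hre]; linarith) (N := N) (by omega)
  rw [h1] at this
  have hsn : ‖s‖ * (2 / N) ≤ 4 := by
    have : ‖s‖ ≤ 2 + |t| := by
      refine (norm_add_le _ _).trans ?_
      gcongr
      · rw [← Complex.ofReal_one, ← Complex.ofReal_add, Complex.norm_real, Real.norm_eq_abs,
          abs_of_nonneg (by linarith)]; linarith
      · simp
    calc ‖s‖ * (2 / N) ≤ (2 * N) * (2 / N) := by gcongr; linarith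
      _ = 4 := by field_simp; norm_num
  have hlog : Real.log N ≤ (1 / ε) * 3 ^ ε * (1 + |t|) ^ ε := by
    calc Real.log N ≤ (N : ℝ) ^ ε / ε := Real.log_le_rpow_div (by linarith) hε
      _ ≤ (3 * (1 + |t|)) ^ ε / ε := by gcongr
      _ = _ := by rw [Real.mul_rpow (by norm_num) (by linarith)]; ring
  have hone : (1 : ℝ) ≤ (1 + |t|) ^ ε := Real.one_le_rpow (by linarith) hε.le
  have h3 : (0 : ℝ) ≤ (1 / ε) * 3 ^ ε := by positivity
  have h4 : 0 ≤ 1 / ‖(α : ℂ) + t * Complex.I‖ := by positivity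
  generalize 1 / ‖(α : ℂ) + t * Complex.I‖ = A at *
  generalize (1 + |t|) ^ ε = B at *
  generalize 1 / ε * 3 ^ ε = D at *
  nlinarith [mul_nonneg h3 h4]

open Complex in
theorem norm_tsum_eq_exp_tsum_primes {g : ℕ →*₀ ℂ} (hsum : Summable (‖g ·‖)) :
    ‖∑' n : ℕ, g n‖ = Real.exp (∑' p : Nat.Primes, (-log (1 - g p)).re) ∧
      Summable (fun p : Nat.Primes => (-log (1 - g p)).re) := by
  have h1 : Summable (fun p : Nat.Primes => -log (1 - g p)) :=
    (hsum.of_norm.clog_one_sub.neg.subtype Nat.Prime)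
  constructor
  · rw [← EulerProduct.exp_tsum_primes_log_eq_tsum hsum, norm_exp, re_tsum h1]
  · exact (hasSum_re h1.hasSum).summable

open Complex in
theorem abs_re_neg_log_one_sub_sub_le {z : ℂ} (hz : ‖z‖ ≤ 1 / 2) :
    |(-log (1 - z)).re - z.re| ≤ ‖z‖ ^ 2 := by
  have h := norm_log_one_add_sub_self_le (z := -z) (by rw [norm_neg]; linarith)
  rw [norm_neg] at h
  have h2 : (1 - ‖z‖)⁻¹ ≤ 2 := by
    rw [inv_le_comm₀ (by linarith) (by norm_num)]; linarith
  have h3 : ‖log (1 + -z) - -z‖ ≤ ‖z‖ ^ 2 := by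
    refine h.trans ?_
    nlinarith [sq_nonneg ‖z‖]
  have h4 := abs_re_le_norm (log (1 + -z) - -z)
  rw [← sub_eq_add_neg] at h4 h3
  rw [← abs_neg]
  refine le_trans (le_of_eq ?_) (h4.trans h3)
  congr 1
  simp
  ring

open Complex in
theorem natCast_cpow_neg_re {n : ℕ} (hn : 0 < n) (σ t : ℝ) :
    ((n : ℂ) ^ (-((σ : ℂ) + t * I))).re = (n : ℝ) ^ (-σ) * Real.cos (t * Real.log n) := by
  have hn' : (n : ℂ) ≠ 0 := by exact_mod_cast hn.ne'
  rw [cpow_def_of_ne_zero hn', ← natCast_log, exp_re]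
  simp only [neg_add_rev, mul_re, ofReal_re, add_re, neg_re, I_re, mul_zero, ofReal_im, I_im,
    mul_one, sub_self, neg_zero, zero_add, add_im, neg_im, mul_im, zero_mul, sub_zero, add_zero]
  rw [Real.rpow_def_of_pos (by exact_mod_cast hn)]
  congr 1
  rw [← Real.cos_neg]
  congr 1
  ring

open Complex in
/-- The completely multiplicative summand `n ↦ f n * n ^ (-s)`. -/
noncomputable def twistHom (f : ℕ →*₀ ℝ) {s : ℂ} (hs : s ≠ 0) : ℕ →*₀ ℂ where
  toFun n := (f n : ℂ) * riemannZetaSummandHom hs n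
  map_zero' := by simp
  map_one' := by simp
  map_mul' m n := by simp only [map_mul, ofReal_mul]; ring

theorem summable_twistHom {f : ℕ →*₀ ℝ} (hf : ∀ n, |f n| ≤ 1) {s : ℂ} (hs : 1 < s.re) :
    Summable (fun n => ‖twistHom f (Complex.ne_zero_of_one_lt_re hs) n‖) := by
  refine Summable.of_nonneg_of_le (fun _ => norm_nonneg _) (fun n => ?_)
    (summable_riemannZetaSummand hs)
  change ‖(f n : ℂ) * riemannZetaSummandHom _ n‖ ≤ _
  rw [norm_mul, Complex.norm_real]
  exact mul_le_of_le_one_left (norm_nonneg _) (hf n)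

theorem LSeries_eq_tsum_twistHom (f : ℕ →*₀ ℝ) {s : ℂ} (hs : s ≠ 0) :
    LSeries (fun n => (f n : ℂ)) s = ∑' n, twistHom f hs n := by
  rw [LSeries]
  congr with n
  rw [LSeries.term_def₀ (by simp)]
  rfl

open Complex in
theorem norm_LSeries_le_zeta_products :
    ∃ C : ℝ, 0 < C ∧ ∀ f : ℕ →*₀ ℝ, (∀ n, |f n| ≤ 1) → ∀ σ t : ℝ, 1 < σ →
      ‖LSeries (fun n => (f n : ℂ)) (σ + t * I)‖ ≤
        C * ‖riemannZeta (σ + (0 : ℝ) * I)‖ ^ (0.698 : ℝ)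
          * ‖riemannZeta (σ + (2 * t : ℝ) * I)‖ ^ (0.354 : ℝ)
          * ‖riemannZeta (σ + (8 * t : ℝ) * I)‖ ^ (0.01 : ℝ) := by
  have hsq : Summable (fun p : Nat.Primes => ((p : ℕ) : ℝ) ^ (-2 : ℝ)) :=
    Nat.Primes.summable_rpow.2 (by norm_num)
  refine ⟨Real.exp (∑' p : Nat.Primes, 3 * ((p : ℕ) : ℝ) ^ (-2 : ℝ)), Real.exp_pos _, ?_⟩
  intro f hf σ t hσ
  have hre : ∀ u : ℝ, 1 < ((σ : ℂ) + u * I).re := by intro u; simpa using hσ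
  have hzeta : ∀ u : ℝ, ‖riemannZeta (σ + u * I)‖
      = Real.exp (∑' p : Nat.Primes, (-log (1 - ((p : ℕ) : ℂ) ^ (-((σ : ℂ) + u * I)))).re) ∧
      Summable (fun p : Nat.Primes => (-log (1 - ((p : ℕ) : ℂ) ^ (-((σ : ℂ) + u * I)))).re) := by
    intro u
    have := norm_tsum_eq_exp_tsum_primes (summable_riemannZetaSummand (hre u))
    rw [tsum_riemannZetaSummand (hre u)] at this
    exact this
  have hs0 : (σ : ℂ) + t * I ≠ 0 := ne_zero_of_one_lt_re (hre t)
  obtain ⟨hF, hFs⟩ := norm_tsum_eq_exp_tsum_primes (summable_twistHom hf (hre t))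
  rw [LSeries_eq_tsum_twistHom f hs0, hF, (hzeta _).1, (hzeta _).1, (hzeta _).1,
    ← Real.exp_mul, ← Real.exp_mul, ← Real.exp_mul, ← Real.exp_add, ← Real.exp_add, ← Real.exp_add,
    ← tsum_mul_right, ← tsum_mul_right, ← tsum_mul_right,
    ← ((hsq.mul_left 3).tsum_add ((hzeta _).2.mul_right _)),
    ← (((hsq.mul_left 3).add ((hzeta _).2.mul_right _)).tsum_add ((hzeta _).2.mul_right _)),
    ← ((((hsq.mul_left 3).add ((hzeta _).2.mul_right _)).add ((hzeta _).2.mul_right _)).tsum_add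
      ((hzeta _).2.mul_right _))]
  apply Real.exp_le_exp.2
  apply hFs.tsum_le_tsum _ ((((hsq.mul_left 3).add ((hzeta _).2.mul_right _)).add
    ((hzeta _).2.mul_right _)).add ((hzeta _).2.mul_right _))
  intro p
  have hp2 : (2 : ℝ) ≤ ((p : ℕ) : ℝ) := by exact_mod_cast p.2.two_le
  have hp0 : 0 < (p : ℕ) := p.2.pos
  have hpσ : ((p : ℕ) : ℝ) ^ (-σ) ≤ 1 / 2 := by
    calc ((p : ℕ) : ℝ) ^ (-σ) ≤ ((p : ℕ) : ℝ) ^ (-1 : ℝ) :=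
          Real.rpow_le_rpow_of_exponent_le (by linarith) (by linarith)
      _ ≤ 2 ^ (-1 : ℝ) := Real.rpow_le_rpow_of_nonpos (by norm_num) hp2 (by norm_num)
      _ = 1 / 2 := by rw [Real.rpow_neg_one]; norm_num
  have hpσ2 : (((p : ℕ) : ℝ) ^ (-σ)) ^ 2 ≤ ((p : ℕ) : ℝ) ^ (-2 : ℝ) := by
    rw [← Real.rpow_mul_natCast (by linarith)]
    apply Real.rpow_le_rpow_of_exponent_le (by linarith)
    push_cast; linarith
  have hpnn : 0 ≤ ((p : ℕ) : ℝ) ^ (-σ) := by positivity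
  have hnorm : ∀ u : ℝ, ‖((p : ℕ) : ℂ) ^ (-((σ : ℂ) + u * I))‖ = ((p : ℕ) : ℝ) ^ (-σ) := by
    intro u
    rw [norm_natCast_cpow_of_pos hp0]; simp
  have hbd : ∀ u : ℝ, ((p : ℕ) : ℝ) ^ (-σ) * Real.cos (u * Real.log p) - ((p : ℕ) : ℝ) ^ (-2 : ℝ)
      ≤ (-log (1 - ((p : ℕ) : ℂ) ^ (-((σ : ℂ) + u * I)))).re := by
    intro u
    have := abs_re_neg_log_one_sub_sub_le (z := ((p : ℕ) : ℂ) ^ (-((σ : ℂ) + u * I)))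
      (by rw [hnorm]; exact hpσ)
    rw [hnorm, natCast_cpow_neg_re hp0] at this
    have := (abs_le.1 this).1
    linarith
  have e : (twistHom f hs0 (p : ℕ)) = (f p : ℂ) * ((p : ℕ) : ℂ) ^ (-((σ : ℂ) + t * I)) := rfl
  have hnt : ‖twistHom f hs0 (p : ℕ)‖ ≤ ((p : ℕ) : ℝ) ^ (-σ) := by
    rw [e, norm_mul, hnorm, norm_real]
    exact mul_le_of_le_one_left hpnn (hf p)
  have hu : (-log (1 - twistHom f hs0 (p : ℕ))).re ≤
      ((p : ℕ) : ℝ) ^ (-σ) * |Real.cos (t * Real.log p)| + ((p : ℕ) : ℝ) ^ (-2 : ℝ) := by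
    have h1 := (abs_le.1 (abs_re_neg_log_one_sub_sub_le (hnt.trans hpσ))).2
    have h2 : (twistHom f hs0 (p : ℕ)).re ≤ ((p : ℕ) : ℝ) ^ (-σ) * |Real.cos (t * Real.log p)| := by
      rw [e, re_ofReal_mul, natCast_cpow_neg_re hp0]
      calc _ ≤ |f p * (((p : ℕ) : ℝ) ^ (-σ) * Real.cos (t * Real.log p))| := le_abs_self _
        _ = |f p| * (((p : ℕ) : ℝ) ^ (-σ) * |Real.cos (t * Real.log p)|) := by
          rw [abs_mul, abs_mul, abs_of_nonneg hpnn]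
        _ ≤ _ := mul_le_of_le_one_left (by positivity) (hf p)
    have h3 : ‖twistHom f hs0 (p : ℕ)‖ ^ 2 ≤ (((p : ℕ) : ℝ) ^ (-σ)) ^ 2 := by gcongr
    linarith
  have htrig := mul_le_mul_of_nonneg_left (abs_cos_le_trig (t * Real.log p)) hpnn
  have b0 := hbd 0
  have b2 := hbd (2 * t)
  have b8 := hbd (8 * t)
  rw [zero_mul, Real.cos_zero] at b0
  rw [mul_assoc] at b2 b8
  have hsqnn : 0 ≤ ((p : ℕ) : ℝ) ^ (-2 : ℝ) := by positivity
  refine hu.trans ?_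
  nlinarith

open Complex in
theorem norm_one_sub_exp_neg_le {z : ℂ} (hz : 0 ≤ z.re) :
    ‖1 - exp (-z)‖ ≤ ‖z‖ ∧ ‖1 - exp (-z)‖ ≤ 2 := by
  have hle : ∀ w : ℂ, 0 ≤ w.re → ‖exp (-w)‖ ≤ 1 := by
    intro w hw; rw [norm_exp]; simpa using hw
  constructor
  · have := Convex.norm_image_sub_le_of_norm_hasDerivWithin_le (𝕜 := ℂ)
      (f := fun w : ℂ => exp (-w)) (f' := fun w => -exp (-w)) (C := 1) (s := {w : ℂ | 0 ≤ w.re})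
      (x := z) (y := 0) ?_ ?_ (convex_halfSpace_re_ge 0) hz (by simp)
    · simpa using this
    · intro w _
      have := (hasDerivAt_neg w).cexp
      simpa using this.hasDerivWithinAt
    · intro w hw
      rw [norm_neg]; exact hle w hw
  · refine (norm_sub_le _ _).trans ?_
    rw [norm_one]; linarith [hle z hz]

open Complex in
theorem exists_norm_LSeries_mul_le :
    ∃ C : ℝ, 0 < C ∧ ∀ f : ℕ →*₀ ℝ, (∀ n, |f n| ≤ 1) → ∀ α t ℓ : ℝ, 0 < α → α ≤ 1 → 0 ≤ ℓ →
      |t| ≤ α ^ (-4 : ℝ) →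
      ‖LSeries (fun n => (f n : ℂ)) (1 + α + t * I)‖ * ‖1 - exp (-(ℓ * (α + t * I)))‖
        ≤ C * α ^ (-0.7 : ℝ) * (2 + ℓ) := by
  obtain ⟨C₀, hC₀, hF⟩ := norm_LSeries_le_zeta_products
  obtain ⟨C₁, hC₁, hZ⟩ := exists_norm_zeta_le (ε := 0.0005) (by norm_num)
  refine ⟨C₀ * (2 * C₁) * (9 * C₁), by positivity, ?_⟩
  intro f hf α t ℓ hα hα1 hℓ ht
  have hαt : (α : ℂ) + t * I ≠ 0 := by
    intro h
    have := congrArg re h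
    simp at this; linarith
  set r := ‖(α : ℂ) + t * I‖ with hr
  have hr0 : 0 < r := norm_pos_iff.2 hαt
  have hF' := hF f hf (1 + α) t (by linarith)
  push_cast at hF'
  have hα4 : 1 ≤ α ^ (-4 : ℝ) := Real.one_le_rpow_of_pos_of_le_one_of_nonpos hα hα1 (by norm_num)
  have hα02 : 1 ≤ α ^ (-0.002 : ℝ) :=
    Real.one_le_rpow_of_pos_of_le_one_of_nonpos hα hα1 (by norm_num)
  have hZ0 : ‖riemannZeta (1 + α + (0 : ℝ) * I)‖ ≤ 2 * C₁ * α ^ (-1 : ℝ) := by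
    refine (hZ α 0 hα hα1).trans ?_
    simp only [ofReal_zero, zero_mul, add_zero, abs_zero, Real.one_rpow, norm_real,
      Real.norm_eq_abs, abs_of_pos hα]
    rw [Real.rpow_neg_one, one_div]
    have : 1 ≤ α⁻¹ := (one_le_inv₀ hα).2 hα1
    nlinarith
  have hW : ∀ c : ℝ, 1 ≤ c → c ≤ 8 → ‖riemannZeta (1 + α + (c * t : ℝ) * I)‖ ≤
      9 * C₁ * α ^ (-0.002 : ℝ) * (1 + 1 / r) := by
    intro c hc hc8
    refine (hZ α (c * t) hα hα1).trans ?_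
    have h1 : r ≤ ‖(α : ℂ) + (c * t : ℝ) * I‖ := by
      rw [hr, norm_add_mul_I, norm_add_mul_I]
      apply Real.sqrt_le_sqrt
      rw [mul_pow]
      have := le_mul_of_one_le_left (sq_nonneg t) (one_le_pow₀ (n := 2) hc)
      linarith
    have h2 : 1 / ‖(α : ℂ) + (c * t : ℝ) * I‖ ≤ 1 / r := one_div_le_one_div_of_le hr0 h1
    have h3 : (1 + |c * t|) ^ (0.0005 : ℝ) ≤ 9 * α ^ (-0.002 : ℝ) := by
      have : 1 + |c * t| ≤ 9 * α ^ (-4 : ℝ) := by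
        rw [abs_mul, abs_of_pos (by linarith)]
        nlinarith [abs_nonneg t]
      calc (1 + |c * t|) ^ (0.0005 : ℝ) ≤ (9 * α ^ (-4 : ℝ)) ^ (0.0005 : ℝ) := by gcongr
        _ = 9 ^ (0.0005 : ℝ) * α ^ (-0.002 : ℝ) := by
          rw [Real.mul_rpow (by norm_num) (by positivity), ← Real.rpow_mul hα.le]
          norm_num
        _ ≤ 9 ^ (1 : ℝ) * α ^ (-0.002 : ℝ) := by
          gcongr <;> norm_num
        _ = _ := by norm_num
    have h4 : 0 < 1 / r := by positivity
    calc C₁ * (1 / ‖(α : ℂ) + (c * t : ℝ) * I‖ + (1 + |c * t|) ^ (0.0005 : ℝ))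
        ≤ C₁ * (1 / r + 9 * α ^ (-0.002 : ℝ)) := by gcongr
      _ ≤ C₁ * (9 * α ^ (-0.002 : ℝ) * (1 / r) + 9 * α ^ (-0.002 : ℝ)) := by
          gcongr; nlinarith
      _ = _ := by ring
  set W := 9 * C₁ * α ^ (-0.002 : ℝ) * (1 + 1 / r) with hWdef
  have h4 : 0 < 1 / r := by positivity
  have hW1 : 1 ≤ W := by
    have a : 1 ≤ 9 * C₁ := by linarith
    have b := one_le_mul_of_one_le_of_one_le a hα02
    exact one_le_mul_of_one_le_of_one_le b (by linarith)
  have hW2 := hW 2 (by norm_num) (by norm_num)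
  have hW8 := hW 8 (by norm_num) (by norm_num)
  push_cast at hW2 hW8 hZ0
  have hprod : ‖riemannZeta (1 + α + 2 * t * I)‖ ^ (0.354 : ℝ) *
      ‖riemannZeta (1 + α + 8 * t * I)‖ ^ (0.01 : ℝ) ≤ W := by
    calc _ ≤ W ^ (0.354 : ℝ) * W ^ (0.01 : ℝ) := by gcongr
      _ = W ^ (0.364 : ℝ) := by rw [← Real.rpow_add (by linarith)]; norm_num
      _ ≤ W ^ (1 : ℝ) := Real.rpow_le_rpow_of_exponent_le hW1 (by norm_num)
      _ = W := Real.rpow_one _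
  have hz0 : ‖riemannZeta (1 + α + 0 * I)‖ ^ (0.698 : ℝ) ≤ 2 * C₁ * α ^ (-0.698 : ℝ) := by
    calc _ ≤ (2 * C₁ * α ^ (-1 : ℝ)) ^ (0.698 : ℝ) := by gcongr
      _ = (2 * C₁) ^ (0.698 : ℝ) * α ^ (-0.698 : ℝ) := by
          rw [Real.mul_rpow (by positivity) (by positivity), ← Real.rpow_mul hα.le]
          norm_num
      _ ≤ (2 * C₁) ^ (1 : ℝ) * α ^ (-0.698 : ℝ) := by
          gcongr
          · linarith
          · norm_num
      _ = _ := by rw [Real.rpow_one]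
  have hre : 0 ≤ ((ℓ : ℂ) * (α + t * I)).re := by
    simp; positivity
  obtain ⟨e1, e2⟩ := norm_one_sub_exp_neg_le hre
  rw [norm_mul, norm_real, Real.norm_eq_abs, abs_of_nonneg hℓ, ← hr] at e1
  have hlast : (1 + 1 / r) * ‖1 - exp (-(ℓ * (α + t * I)))‖ ≤ 2 + ℓ := by
    rw [add_mul, one_mul]
    have : 1 / r * ‖1 - exp (-(ℓ * (α + t * I)))‖ ≤ 1 / r * (ℓ * r) := by gcongr
    have h5 : 1 / r * (ℓ * r) = ℓ := by field_simp
    linarith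
  calc _ ≤ (C₀ * (2 * C₁ * α ^ (-0.698 : ℝ)) * W) * ‖1 - exp (-(ℓ * (α + t * I)))‖ := by
        gcongr
        refine hF'.trans ?_
        rw [mul_assoc]
        gcongr
    _ = C₀ * (2 * C₁) * (9 * C₁) * (α ^ (-0.698 : ℝ) * α ^ (-0.002 : ℝ)) *
        ((1 + 1 / r) * ‖1 - exp (-(ℓ * (α + t * I)))‖) := by rw [hWdef]; ring
    _ = C₀ * (2 * C₁) * (9 * C₁) * α ^ (-0.7 : ℝ) *
        ((1 + 1 / r) * ‖1 - exp (-(ℓ * (α + t * I)))‖) := by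
          rw [← Real.rpow_add hα]; norm_num
    _ ≤ _ := by gcongr

/-- The normalised summatory function `u ↦ e^{-u} ∑_{n ≤ e^u} a n` in the logarithmic scale. -/
noncomputable def logMean (a : ℕ → ℝ) (u : ℝ) : ℝ :=
  Real.exp (-u) * ∑ n ∈ Finset.Icc 1 ⌊Real.exp u⌋₊, a n

theorem logMean_of_neg (a : ℕ → ℝ) {u : ℝ} (hu : u < 0) : logMean a u = 0 := by
  have : ⌊Real.exp u⌋₊ = 0 := Nat.floor_eq_zero.2 (Real.exp_lt_one_iff.2 hu)
  simp [logMean, this]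

theorem logMean_log (a : ℕ → ℝ) {x : ℝ} (hx : 0 < x) :
    logMean a (Real.log x) = (1 / x) * ∑ n ∈ Finset.Icc 1 ⌊x⌋₊, a n := by
  rw [logMean, Real.exp_neg, Real.exp_log hx, one_div]

theorem abs_logMean_le {a : ℕ → ℝ} {B : ℝ} {u : ℝ} (hB : 0 ≤ B)
    (ha : ∀ n ∈ Finset.Icc 1 ⌊Real.exp u⌋₊, |a n| ≤ B) : |logMean a u| ≤ B := by
  rw [logMean, abs_mul, abs_of_pos (Real.exp_pos _)]
  have h1 : |∑ n ∈ Finset.Icc 1 ⌊Real.exp u⌋₊, a n| ≤ Real.exp u * B := by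
    refine (Finset.abs_sum_le_sum_abs _ _).trans ((Finset.sum_le_card_nsmul _ _ _ ha).trans ?_)
    rw [nsmul_eq_mul, Nat.card_Icc, Nat.add_sub_cancel]
    gcongr
    exact Nat.floor_le (Real.exp_pos u).le
  calc _ ≤ Real.exp (-u) * (Real.exp u * B) := by gcongr
    _ = B := by rw [← mul_assoc, ← Real.exp_add]; simp

theorem logMean_convolution (a b : ArithmeticFunction ℝ) (u : ℝ) {K : ℕ}
    (hK : ⌊Real.exp u⌋₊ ≤ K) :
    logMean (fun n => (a * b) n) u = ∑ k ∈ Finset.Icc 1 K, a k / k * logMean b (u - Real.log k) := by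
  have h0 : ∑ k ∈ Finset.Icc 1 K, a k / k * logMean b (u - Real.log k) =
      ∑ k ∈ Finset.Icc 1 ⌊Real.exp u⌋₊, a k / k * logMean b (u - Real.log k) := by
    symm
    apply Finset.sum_subset (Finset.Icc_subset_Icc_right hK)
    intro k hk hk'
    rw [Finset.mem_Icc] at hk hk'
    have hlt : Real.exp u < k := by
      refine (Nat.floor_lt (Real.exp_pos u).le).1 ?_
      by_contra hcon
      exact hk' ⟨hk.1, not_lt.1 hcon⟩
    have : u < Real.log k := by
      rwa [Real.lt_log_iff_exp_lt (by exact_mod_cast hk.1)]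
    rw [logMean_of_neg _ (by linarith), mul_zero]
  have h1 := ArithmeticFunction.sum_Ioc_mul_eq_sum_sum a b ⌊Real.exp u⌋₊
  rw [h0, logMean]
  change ∑ n ∈ Finset.Icc 1 ⌊Real.exp u⌋₊, (a * b) n =
    ∑ n ∈ Finset.Icc 1 ⌊Real.exp u⌋₊, a n * ∑ m ∈ Finset.Icc 1 (⌊Real.exp u⌋₊ / n), b m at h1
  rw [h1, Finset.mul_sum]
  apply Finset.sum_congr rfl
  intro k hk
  have hk0 : (0 : ℝ) < k := by exact_mod_cast (Finset.mem_Icc.1 hk).1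
  rw [logMean, Real.exp_sub, Real.exp_log hk0, Nat.floor_div_natCast, neg_sub, Real.exp_sub,
    Real.exp_log hk0, Real.exp_neg]
  change _ * (_ * ∑ m ∈ Finset.Icc 1 _, b m) = _
  field_simp

theorem sum_vonMangoldt_div_le (N : ℕ) :
    ∑ k ∈ Finset.Icc 1 N, ArithmeticFunction.vonMangoldt k / k ≤ 2 * Real.log N := by
  rcases Nat.eq_zero_or_pos N with rfl | hN
  · simp
  have hN' : (0 : ℝ) < N := by exact_mod_cast hN
  have h := ArithmeticFunction.sum_Ioc_mul_zeta_eq_sum ArithmeticFunction.vonMangoldt N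
  rw [ArithmeticFunction.vonMangoldt_mul_zeta] at h
  change ∑ n ∈ Finset.Icc 1 N, Real.log n = ∑ n ∈ Finset.Icc 1 N, _ at h
  have h1 : ∑ n ∈ Finset.Icc 1 N, Real.log n ≤ N * Real.log N := by
    refine (Finset.sum_le_card_nsmul _ _ (Real.log N) ?_).trans ?_
    · intro n hn
      rw [Finset.mem_Icc] at hn
      exact Real.log_le_log (by exact_mod_cast hn.1) (by exact_mod_cast hn.2)
    · rw [nsmul_eq_mul, Nat.card_Icc, Nat.add_sub_cancel]
  have h2 : ∑ k ∈ Finset.Icc 1 N, ArithmeticFunction.vonMangoldt k / k * (N / 2) ≤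
      ∑ k ∈ Finset.Icc 1 N, ArithmeticFunction.vonMangoldt k * ((N / k : ℕ) : ℝ) := by
    apply Finset.sum_le_sum
    intro k hk
    rw [Finset.mem_Icc] at hk
    have hk0 : (0 : ℝ) < k := by exact_mod_cast hk.1
    have h3 : (N : ℝ) / k / 2 ≤ ((N / k : ℕ) : ℝ) := by
      have e1 : N < k * (N / k + 1) := Nat.lt_mul_div_succ N hk.1
      have e2 : 1 ≤ N / k := Nat.div_pos hk.2 hk.1
      have e3 : (N : ℝ) / k < ((N / k : ℕ) : ℝ) + 1 := by
        rw [div_lt_iff₀ hk0, mul_comm]; exact_mod_cast e1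
      have e4 : (1 : ℝ) ≤ ((N / k : ℕ) : ℝ) := by exact_mod_cast e2
      linarith
    calc _ = ArithmeticFunction.vonMangoldt k * ((N : ℝ) / k / 2) := by ring
      _ ≤ _ := mul_le_mul_of_nonneg_left h3 ArithmeticFunction.vonMangoldt_nonneg
  rw [← Finset.sum_mul] at h2
  have h4 := h2.trans (h.ge.trans h1)
  nlinarith

theorem sum_log_eq_log_factorial (N : ℕ) :
    ∑ n ∈ Finset.Icc 1 N, Real.log n = Real.log N.factorial := by
  induction N with
  | zero => simp
  | succ N ih =>
    rw [Finset.sum_Icc_succ_top (by omega), ih, Nat.factorial_succ, Nat.cast_mul,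
      Real.log_mul (by positivity) (by positivity), add_comm]

theorem abs_logMean_mul_log_sub_le {f : ℕ → ℝ} (hf : ∀ n, |f n| ≤ 1) (u : ℝ) :
    |logMean (fun n => f n * Real.log n) u - u * logMean f u| ≤ 1 := by
  set N := ⌊Real.exp u⌋₊ with hN
  have h1 : logMean (fun n => f n * Real.log n) u - u * logMean f u =
      Real.exp (-u) * ∑ n ∈ Finset.Icc 1 N, f n * (Real.log n - u) := by
    simp only [logMean, mul_sub, Finset.sum_sub_distrib, ← Finset.sum_mul]
    ring
  rw [h1, abs_mul, abs_of_pos (Real.exp_pos _)]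
  have h2 : |∑ n ∈ Finset.Icc 1 N, f n * (Real.log n - u)| ≤ Real.exp u := by
    calc _ ≤ ∑ n ∈ Finset.Icc 1 N, |f n * (Real.log n - u)| := Finset.abs_sum_le_sum_abs _ _
      _ ≤ ∑ n ∈ Finset.Icc 1 N, (u - Real.log n) := by
        apply Finset.sum_le_sum
        intro n hn
        rw [Finset.mem_Icc] at hn
        have : Real.log n ≤ u := by
          rw [Real.log_le_iff_le_exp (by exact_mod_cast hn.1)]
          exact (Nat.le_floor_iff (Real.exp_pos u).le).1 hn.2
        rw [abs_mul, abs_of_nonpos (by linarith : Real.log n - u ≤ 0), neg_sub]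
        exact mul_le_of_le_one_left (by linarith) (hf n)
      _ = N * u - Real.log (N.factorial) := by
        rw [Finset.sum_sub_distrib, sum_log_eq_log_factorial, Finset.sum_const,
          Nat.card_Icc, Nat.add_sub_cancel, nsmul_eq_mul]
      _ ≤ Real.exp u := by
        have h3 := Real.pow_div_factorial_le_exp (Real.exp u) (Real.exp_pos u).le N
        have h4 : (0 : ℝ) < N.factorial := by exact_mod_cast N.factorial_pos
        have h5 := Real.log_le_log (by positivity) h3
        rw [Real.log_exp, Real.log_div (by positivity) h4.ne', Real.log_pow, Real.log_exp] at h5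
        exact h5
  calc _ ≤ Real.exp (-u) * Real.exp u := by gcongr
    _ = 1 := by rw [← Real.exp_add]; simp

theorem abs_logMean_mul_log_le {f : ℕ → ℝ} (hf : ∀ n, |f n| ≤ 1) {u : ℝ} (hu : 0 ≤ u) :
    |logMean (fun n => f n * Real.log n) u| ≤ u := by
  apply abs_logMean_le hu
  intro n hn
  rw [Finset.mem_Icc] at hn
  have hn1 : (1 : ℝ) ≤ n := by exact_mod_cast hn.1
  rw [abs_mul, abs_of_nonneg (Real.log_nonneg hn1)]
  have : Real.log n ≤ u := by
    rw [Real.log_le_iff_le_exp (by linarith)]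
    exact (Nat.le_floor_iff (Real.exp_pos u).le).1 hn.2
  exact (mul_le_of_le_one_left (Real.log_nonneg hn1) (hf n)).trans this

theorem measurable_logMean (a : ℕ → ℝ) : Measurable (logMean a) := by
  unfold logMean
  apply Measurable.mul (by fun_prop)
  exact (measurable_from_nat (f := fun N : ℕ => ∑ n ∈ Finset.Icc 1 N, a n)).comp
    (Nat.measurable_floor.comp Real.measurable_exp)

/-- The difference of `logMean a` between `u` and `u - ℓ`. -/
noncomputable def logMeanDiff (a : ℕ → ℝ) (ℓ u : ℝ) : ℝ :=
  logMean a u - logMean a (u - ℓ)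

theorem logMeanDiff_of_neg (a : ℕ → ℝ) {ℓ u : ℝ} (hℓ : 0 ≤ ℓ) (hu : u < 0) :
    logMeanDiff a ℓ u = 0 := by
  rw [logMeanDiff, logMean_of_neg _ hu, logMean_of_neg _ (by linarith), sub_zero]

theorem measurable_logMeanDiff (a : ℕ → ℝ) (ℓ : ℝ) : Measurable (logMeanDiff a ℓ) := by
  unfold logMeanDiff
  exact (measurable_logMean a).sub ((measurable_logMean a).comp (measurable_id.sub_const ℓ))

theorem abs_logMeanDiff_le_two {f : ℕ → ℝ} (hf : ∀ n, |f n| ≤ 1) (ℓ u : ℝ) :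
    |logMeanDiff f ℓ u| ≤ 2 := by
  have h1 := abs_logMean_le (u := u) zero_le_one (fun n _ => hf n)
  have h2 := abs_logMean_le (u := u - ℓ) zero_le_one (fun n _ => hf n)
  exact (abs_sub _ _).trans (by linarith)

theorem abs_logMeanDiff_mul_log_sub_le {f : ℕ → ℝ} (hf : ∀ n, |f n| ≤ 1) {ℓ : ℝ} (hℓ : 0 ≤ ℓ)
    (u : ℝ) :
    |logMeanDiff (fun n => f n * Real.log n) ℓ u - u * logMeanDiff f ℓ u| ≤ 2 + ℓ := by
  have h1 := abs_logMean_mul_log_sub_le hf u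
  have h2 := abs_logMean_mul_log_sub_le hf (u - ℓ)
  have h3 := abs_logMean_le (u := u - ℓ) zero_le_one (fun n _ => hf n)
  have h4 : |ℓ * logMean f (u - ℓ)| ≤ ℓ := by
    rw [abs_mul, abs_of_nonneg hℓ]; exact mul_le_of_le_one_right hℓ h3
  rw [abs_le] at *
  unfold logMeanDiff
  constructor <;> linarith

theorem logMeanDiff_convolution (a b : ArithmeticFunction ℝ) {ℓ : ℝ} (hℓ : 0 ≤ ℓ) (u : ℝ) {K : ℕ}
    (hK : ⌊Real.exp u⌋₊ ≤ K) :
    logMeanDiff (fun n => (a * b) n) ℓ u =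
      ∑ k ∈ Finset.Icc 1 K, a k / k * logMeanDiff b ℓ (u - Real.log k) := by
  have hK' : ⌊Real.exp (u - ℓ)⌋₊ ≤ K :=
    (Nat.floor_le_floor (Real.exp_le_exp.2 (by linarith))).trans hK
  rw [logMeanDiff, logMean_convolution a b u hK, logMean_convolution a b (u - ℓ) hK',
    ← Finset.sum_sub_distrib]
  apply Finset.sum_congr rfl
  intro k _
  rw [logMeanDiff, mul_sub, show u - Real.log k - ℓ = u - ℓ - Real.log k by ring]

theorem sum_divisorsAntidiagonal_vonMangoldt_mul (f : ℕ →*₀ ℝ) (n : ℕ) :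
    ∑ p ∈ n.divisorsAntidiagonal, (ArithmeticFunction.vonMangoldt p.1 * f p.1) * f p.2 =
      f n * Real.log n := by
  rw [← ArithmeticFunction.vonMangoldt_sum, Finset.mul_sum,
    Nat.sum_divisorsAntidiagonal
      (f := fun a b => (ArithmeticFunction.vonMangoldt a * f a) * f b)]
  apply Finset.sum_congr rfl
  intro d hd
  have := Nat.mul_div_cancel' (Nat.dvd_of_mem_divisors hd)
  rw [mul_assoc, ← map_mul, this, mul_comm]

theorem abs_logMeanDiff_mul_log_le_sum {f : ℕ →*₀ ℝ} (hf : ∀ n, |f n| ≤ 1) {ℓ : ℝ} (hℓ : 0 ≤ ℓ)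
    (u : ℝ) {K : ℕ} (hK : ⌊Real.exp u⌋₊ ≤ K) :
    |logMeanDiff (fun n => f n * Real.log n) ℓ u| ≤
      ∑ k ∈ Finset.Icc 1 K,
        ArithmeticFunction.vonMangoldt k / k * |logMeanDiff f ℓ (u - Real.log k)| := by
  let F : ArithmeticFunction ℝ := ⟨f, map_zero f⟩
  have h := logMeanDiff_convolution (ArithmeticFunction.vonMangoldt.pmul F) F hℓ u hK
  have e : (fun n => (ArithmeticFunction.vonMangoldt.pmul F * F) n) =
      fun n => f n * Real.log n := by
    funext n
    rw [ArithmeticFunction.mul_apply, ← sum_divisorsAntidiagonal_vonMangoldt_mul]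
    rfl
  rw [e] at h
  rw [h]
  refine (Finset.abs_sum_le_sum_abs _ _).trans (Finset.sum_le_sum fun k _ => ?_)
  rw [abs_mul]
  change |ArithmeticFunction.vonMangoldt k * f k / k| * |logMeanDiff f ℓ _| ≤ _
  gcongr
  rw [abs_div, abs_mul, abs_of_nonneg ArithmeticFunction.vonMangoldt_nonneg, Nat.abs_cast]
  gcongr
  exact mul_le_of_le_one_right ArithmeticFunction.vonMangoldt_nonneg (hf k)

open MeasureTheory FourierTransform Complex in
theorem fourier_comp_sub_right (H : ℝ → ℂ) (ℓ ξ : ℝ) :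
    𝓕 (fun u => H (u - ℓ)) ξ = exp (-(2 * Real.pi * ξ * ℓ * I)) * 𝓕 H ξ := by
  rw [Real.fourier_real_eq_integral_exp_smul, Real.fourier_real_eq_integral_exp_smul,
    ← integral_sub_right_eq_self (fun v => exp (↑(-2 * Real.pi * v * ξ) * I) • H v) ℓ,
    ← integral_const_mul]
  apply integral_congr_ae
  filter_upwards with v
  simp only [smul_eq_mul]
  rw [← mul_assoc, ← Complex.exp_add]
  push_cast
  ring_nf

open MeasureTheory FourierTransform Complex Asymptotics Filter in
theorem fourier_logMean_mul_exp {a : ℕ → ℝ} {r α : ℝ} (hr : 0 ≤ r) (hrα : r < 1 + α) (ξ : ℝ)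
    (hS : LSeriesSummable (fun n => (a n : ℂ)) (1 + α + (2 * Real.pi * ξ : ℝ) * I))
    (hO : (fun n => ∑ k ∈ Finset.Icc 1 n, a k) =O[atTop] fun n => (n : ℝ) ^ r) :
    𝓕 (fun u : ℝ => ((logMean a u * Real.exp (-(α * u)) : ℝ) : ℂ)) ξ =
      LSeries (fun n => (a n : ℂ)) (1 + α + (2 * Real.pi * ξ : ℝ) * I) /
        (1 + α + (2 * Real.pi * ξ : ℝ) * I) := by
  set s : ℂ := 1 + α + (2 * Real.pi * ξ : ℝ) * I with hs
  have hsre : s.re = 1 + α := by simp [hs]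
  have hsim : s.im = 2 * Real.pi * ξ := by simp [hs]
  have hs0 : s ≠ 0 := by
    intro h; rw [h, zero_re] at hsre; linarith
  have hO' : (fun n => ∑ k ∈ Finset.Icc 1 n, (a k : ℂ)) =O[atTop] fun n => (n : ℝ) ^ r := by
    refine IsBigO.of_norm_left ?_
    simpa [← ofReal_sum] using hO
  rw [LSeries_eq_mul_integral _ hr (by rw [hsre]; exact hrα) hS hO', mul_div_cancel_left₀ _ hs0]
  set A : ℝ → ℂ := fun t => ∑ k ∈ Finset.Icc 1 ⌊t⌋₊, (a k : ℂ) with hA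
  have h1 : ∫ t in Set.Ioi (1 : ℝ), (∑ k ∈ Finset.Icc 1 ⌊t⌋₊, (a k : ℂ)) * (t : ℂ) ^ (-(s + 1)) =
      mellin A (-s) := by
    rw [mellin, ← integral_indicator measurableSet_Ioi, ← integral_indicator measurableSet_Ioi]
    apply integral_congr_ae
    have : ∀ᵐ t : ℝ, t ≠ 1 := by
      simp [ae_iff]
    filter_upwards [this] with t ht
    simp only [Set.indicator, Set.mem_Ioi]
    split_ifs with h2 h3 h3
    · rw [smul_eq_mul, mul_comm, neg_add']
    · exact absurd (zero_lt_one.trans h2) h3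
    · have : ⌊t⌋₊ = 0 := Nat.floor_eq_zero.2 (lt_of_le_of_ne (not_lt.1 h2) ht)
      simp [hA, this]
    · rfl
  rw [h1, ← mellin_comp_inv, mellin_eq_fourier, hsim, hsre]
  have : 2 * Real.pi * ξ / (2 * Real.pi) = ξ := by field_simp
  rw [this]
  refine congrArg (fun F : ℝ → ℂ => 𝓕 F ξ) ?_
  funext u
  rw [← Real.exp_neg, neg_neg, hA, logMean, real_smul]
  push_cast
  rw [mul_right_comm, ← Complex.exp_add]
  ring_nf

open MeasureTheory in
theorem integrable_memLp_mul_exp {g : ℝ → ℝ} {B α : ℝ} (hα : 0 < α) (hg : Measurable g)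
    (h0 : ∀ u < 0, g u = 0) (hB : ∀ u, 0 ≤ u → |g u| ≤ B * Real.exp (α / 2 * u)) :
    Integrable (fun u => ((g u * Real.exp (-(α * u)) : ℝ) : ℂ)) ∧
      MemLp (fun u => ((g u * Real.exp (-(α * u)) : ℝ) : ℂ)) 2 := by
  have hmeas : AEStronglyMeasurable (fun u => ((g u * Real.exp (-(α * u)) : ℝ) : ℂ)) :=
    (by fun_prop : Measurable (fun u => ((g u * Real.exp (-(α * u)) : ℝ) : ℂ))).aestronglyMeasurable
  have hi : ∀ c : ℝ, 0 < c →
      Integrable (Set.indicator (Set.Ici (0 : ℝ)) (fun u => B * Real.exp (-(c * u)))) := by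
    intro c hc
    rw [integrable_indicator_iff measurableSet_Ici, integrableOn_Ici_iff_integrableOn_Ioi]
    have := (integrableOn_exp_mul_Ioi (a := -c) (by linarith) 0).const_mul B
    simpa [IntegrableOn] using this
  have hle : ∀ u, ‖((g u * Real.exp (-(α * u)) : ℝ) : ℂ)‖ ≤
      Set.indicator (Set.Ici (0 : ℝ)) (fun u => B * Real.exp (-(α / 2 * u))) u := by
    intro u
    rw [Complex.norm_real, Real.norm_eq_abs, abs_mul, abs_of_pos (Real.exp_pos _)]
    by_cases hu : 0 ≤ u
    · rw [Set.indicator_of_mem (Set.mem_Ici.2 hu)]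
      calc _ ≤ B * Real.exp (α / 2 * u) * Real.exp (-(α * u)) := by gcongr; exact hB u hu
        _ = _ := by rw [mul_assoc, ← Real.exp_add]; ring_nf
    · rw [Set.indicator_of_notMem (by simpa using hu), h0 u (not_le.1 hu)]
      simp
  refine ⟨(hi (α / 2) (by linarith)).mono' hmeas (Filter.Eventually.of_forall hle), ?_⟩
  rw [memLp_two_iff_integrable_sq_norm hmeas]
  have h2 := (hi α hα).const_mul B
  refine h2.mono' (hmeas.norm.pow 2) (Filter.Eventually.of_forall fun u => ?_)
  rw [Real.norm_eq_abs, abs_of_nonneg (by positivity)]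
  refine (pow_le_pow_left₀ (norm_nonneg _) (hle u) 2).trans (le_of_eq ?_)
  by_cases hu : 0 ≤ u
  · rw [Set.indicator_of_mem (Set.mem_Ici.2 hu), Set.indicator_of_mem (Set.mem_Ici.2 hu), mul_pow,
      sq (Real.exp _), ← Real.exp_add]
    ring_nf
  · rw [Set.indicator_of_notMem (by simpa using hu), Set.indicator_of_notMem (by simpa using hu)]
    simp

open Complex in
theorem LSeriesSummable_of_abs_le_one {f : ℕ → ℝ} (hf : ∀ n, |f n| ≤ 1) {s : ℂ} (hs : 1 < s.re) :
    LSeriesSummable (fun n => (f n : ℂ)) s :=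
  LSeriesSummable_of_bounded_of_one_lt_re (m := 1)
    (fun n _ => by rw [norm_real]; exact hf n) hs

open Complex in
theorem LSeriesSummable_vonMangoldt_mul {f : ℕ → ℝ} (hf : ∀ n, |f n| ≤ 1) {s : ℂ}
    (hs : 1 < s.re) :
    LSeriesSummable (fun n => ((ArithmeticFunction.vonMangoldt n * f n : ℝ) : ℂ)) s := by
  refine Summable.of_norm_bounded (ArithmeticFunction.LSeriesSummable_vonMangoldt hs).norm ?_
  intro n
  apply LSeries.norm_term_le
  rw [norm_real, norm_real, norm_mul]
  exact mul_le_of_le_one_right (norm_nonneg _) (hf n)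

open Complex in
theorem LSeries_mul_log_eq {f : ℕ →*₀ ℝ} (hf : ∀ n, |f n| ≤ 1) {s : ℂ} (hs : 1 < s.re) :
    LSeries (fun n => ((f n * Real.log n : ℝ) : ℂ)) s =
      LSeries (fun n => ((ArithmeticFunction.vonMangoldt n * f n : ℝ) : ℂ)) s *
        LSeries (fun n => (f n : ℂ)) s := by
  rw [← LSeries_convolution' (LSeriesSummable_vonMangoldt_mul hf hs)
    (LSeriesSummable_of_abs_le_one hf hs)]
  congr 1
  funext n
  rw [LSeries.convolution_def, ← sum_divisorsAntidiagonal_vonMangoldt_mul]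
  push_cast
  rfl

open Complex in
theorem tsum_rpow_neg_le_norm_zeta {β : ℝ} (hβ : 0 < β) :
    ∑' n : ℕ, 1 / (n : ℝ) ^ (1 + β) ≤ ‖riemannZeta (1 + β + (0 : ℝ) * I)‖ := by
  have : (1 : ℂ) + β + (0 : ℝ) * I = ((1 + β : ℝ) : ℂ) := by push_cast; ring
  rw [this, zeta_eq_tsum_one_div_nat_cpow (by simpa using hβ)]
  have h : ∀ n : ℕ, 1 / (n : ℂ) ^ ((1 + β : ℝ) : ℂ) = ((1 / (n : ℝ) ^ (1 + β) : ℝ) : ℂ) := by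
    intro n
    rw [ofReal_div, ofReal_cpow n.cast_nonneg]
    simp
  simp_rw [h]
  rw [← ofReal_tsum, norm_real]
  exact Real.le_norm_self _

open Complex in
theorem norm_term_mul_log_le {f : ℕ → ℝ} (hf : ∀ n, |f n| ≤ 1) {α : ℝ} (hα : 0 < α) (t : ℝ)
    (n : ℕ) :
    ‖LSeries.term (fun n => ((f n * Real.log n : ℝ) : ℂ)) (1 + α + t * I) n‖ ≤
      2 / α * (1 / (n : ℝ) ^ (1 + α / 2)) := by
  rw [LSeries.norm_term_eq]
  split_ifs with h
  · positivity
  have hn : (0 : ℝ) < n := by exact_mod_cast Nat.pos_of_ne_zero h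
  have h1 : ‖((f n * Real.log n : ℝ) : ℂ)‖ ≤ (n : ℝ) ^ (α / 2) / (α / 2) := by
    rw [norm_real, norm_mul]
    refine (mul_le_of_le_one_left (norm_nonneg _) (hf n)).trans ?_
    rw [Real.norm_of_nonneg (Real.log_natCast_nonneg n)]
    exact Real.log_natCast_le_rpow_div n (by linarith)
  have h2 : (1 + (α : ℂ) + t * I).re = 1 + α := by simp
  rw [h2]
  calc _ ≤ (n : ℝ) ^ (α / 2) / (α / 2) / (n : ℝ) ^ (1 + α) := by gcongr
    _ = _ := by
      have : (n : ℝ) ^ (1 + α) = (n : ℝ) ^ (α / 2) * (n : ℝ) ^ (1 + α / 2) := by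
        rw [← Real.rpow_add hn]; ring_nf
      rw [this]
      field_simp

theorem summable_one_div_rpow_one_add {β : ℝ} (hβ : 0 < β) :
    Summable (fun n : ℕ => 1 / (n : ℝ) ^ (1 + β)) :=
  Real.summable_one_div_nat_rpow.2 (by linarith)

open Complex in
theorem LSeriesSummable_mul_log {f : ℕ → ℝ} (hf : ∀ n, |f n| ≤ 1) {α : ℝ} (hα : 0 < α) (t : ℝ) :
    LSeriesSummable (fun n => ((f n * Real.log n : ℝ) : ℂ)) (1 + α + t * I) :=
  Summable.of_norm_bounded ((summable_one_div_rpow_one_add (half_pos hα)).mul_left (2 / α))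
    (norm_term_mul_log_le hf hα t)

open Complex in
theorem exists_norm_LSeries_mul_log_le :
    ∃ C : ℝ, 0 < C ∧ ∀ f : ℕ → ℝ, (∀ n, |f n| ≤ 1) → ∀ α t : ℝ, 0 < α → α ≤ 1 →
      ‖LSeries (fun n => ((f n * Real.log n : ℝ) : ℂ)) (1 + α + t * I)‖ ≤ C / α ^ 2 := by
  obtain ⟨C, hC, hZ⟩ := exists_norm_zeta_le (ε := 1) one_pos
  refine ⟨6 * C, by positivity, fun f hf α t hα hα1 => ?_⟩
  have h1 := tsum_of_norm_bounded
    ((summable_one_div_rpow_one_add (half_pos hα)).mul_left (2 / α)).hasSum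
    (norm_term_mul_log_le hf hα t)
  refine h1.trans ?_
  rw [tsum_mul_left]
  have h2 := (tsum_rpow_neg_le_norm_zeta (half_pos hα)).trans
    (hZ (α / 2) 0 (half_pos hα) (by linarith))
  have h3 : C * (1 / ‖((α / 2 : ℝ) : ℂ) + (0 : ℝ) * I‖ + (1 + |(0 : ℝ)|) ^ (1 : ℝ)) ≤
      3 * C / α := by
    have : (((α / 2 : ℝ) : ℂ) + (0 : ℝ) * I) = ((α / 2 : ℝ) : ℂ) := by simp
    rw [this, norm_real, Real.norm_of_nonneg (by positivity)]
    have : 1 ≤ 1 / α := (one_le_div hα).2 hα1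
    simp only [abs_zero, add_zero, Real.one_rpow]
    calc C * (1 / (α / 2) + 1) ≤ C * (1 / (α / 2) + 1 / α) := by gcongr
      _ = _ := by field_simp; ring
  calc _ ≤ 2 / α * (3 * C / α) := by gcongr; exact h2.trans h3
    _ = _ := by field_simp; ring

open Asymptotics Filter in
theorem isBigO_sum_mul_log {f : ℕ → ℝ} (hf : ∀ n, |f n| ≤ 1) {ε : ℝ} (hε : 0 < ε) :
    (fun n : ℕ => ∑ k ∈ Finset.Icc 1 n, f k * Real.log k) =O[atTop]
      fun n => (n : ℝ) ^ (1 + ε) := by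
  refine IsBigO.of_bound (1 / ε) (Eventually.of_forall fun n => ?_)
  refine (norm_sum_le _ _).trans ((Finset.sum_le_card_nsmul _ _ ((n : ℝ) ^ ε / ε) ?_).trans ?_)
  · intro k hk
    rw [Finset.mem_Icc] at hk
    rw [norm_mul]
    refine (mul_le_of_le_one_left (norm_nonneg _) (hf k)).trans ?_
    rw [Real.norm_of_nonneg (Real.log_natCast_nonneg k)]
    refine (Real.log_natCast_le_rpow_div k hε).trans ?_
    have := hk.2
    gcongr
  · rw [nsmul_eq_mul, Nat.card_Icc, Nat.add_sub_cancel, Real.norm_of_nonneg (by positivity),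
      Real.rpow_one_add' n.cast_nonneg (by positivity)]
    apply le_of_eq
    ring

theorem abs_sum_vonMangoldt_mul_le {f : ℕ → ℝ} (hf : ∀ n, |f n| ≤ 1) {x : ℝ} (hx : 0 ≤ x) :
    |∑ k ∈ Finset.Icc 1 ⌊x⌋₊, ArithmeticFunction.vonMangoldt k * f k| ≤ 6 * x := by
  refine (Finset.abs_sum_le_sum_abs _ _).trans ?_
  have h1 : ∑ k ∈ Finset.Icc 1 ⌊x⌋₊, |ArithmeticFunction.vonMangoldt k * f k| ≤
      Chebyshev.psi x := by
    rw [Chebyshev.psi]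
    change _ ≤ ∑ k ∈ Finset.Icc 1 ⌊x⌋₊, _
    apply Finset.sum_le_sum
    intro k _
    rw [abs_mul, abs_of_nonneg ArithmeticFunction.vonMangoldt_nonneg]
    exact mul_le_of_le_one_right ArithmeticFunction.vonMangoldt_nonneg (hf k)
  refine h1.trans ((Chebyshev.psi_le_const_mul_self hx).trans ?_)
  gcongr
  have : Real.log 4 = 2 * Real.log 2 := by
    rw [show (4 : ℝ) = 2 ^ 2 by norm_num, Real.log_pow]; norm_num
  linarith [Real.log_two_lt_d9]

open Asymptotics Filter in
theorem isBigO_sum_vonMangoldt_mul {f : ℕ → ℝ} (hf : ∀ n, |f n| ≤ 1) :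
    (fun n : ℕ => ∑ k ∈ Finset.Icc 1 n, ArithmeticFunction.vonMangoldt k * f k) =O[atTop]
      fun n => (n : ℝ) ^ (1 : ℝ) := by
  refine IsBigO.of_bound 6 (Eventually.of_forall fun n => ?_)
  have := abs_sum_vonMangoldt_mul_le hf (x := n) n.cast_nonneg
  rw [Nat.floor_natCast] at this
  rw [Real.rpow_one, Real.norm_natCast]
  exact this

theorem abs_logMean_vonMangoldt_mul_le {f : ℕ → ℝ} (hf : ∀ n, |f n| ≤ 1) (u : ℝ) :
    |logMean (fun n => ArithmeticFunction.vonMangoldt n * f n) u| ≤ 6 := by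
  rw [logMean, abs_mul, abs_of_pos (Real.exp_pos _)]
  calc _ ≤ Real.exp (-u) * (6 * Real.exp u) := by
        gcongr; exact abs_sum_vonMangoldt_mul_le hf (Real.exp_pos u).le
    _ = 6 := by rw [mul_left_comm, ← Real.exp_add]; simp

open MeasureTheory FourierTransform Complex in
theorem fourier_sub_const_mul_comp_sub {H : ℝ → ℂ} (hH : Integrable H) (c : ℂ) (ℓ ξ : ℝ) :
    𝓕 (fun u => H u - c * H (u - ℓ)) ξ =
      (1 - c * exp (-(2 * Real.pi * ξ * ℓ * I))) * 𝓕 H ξ := by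
  have hH' : Integrable (fun u => H (u - ℓ)) := hH.comp_sub_right ℓ
  have key : ∀ K : ℝ → ℂ, Integrable K →
      Integrable (fun v : ℝ => exp (↑(-2 * Real.pi * v * ξ) * I) • K v) := by
    intro K hK
    have hm : AEStronglyMeasurable (fun v : ℝ => exp (↑(-2 * Real.pi * v * ξ) * I)) :=
      (by fun_prop : Measurable fun v : ℝ =>
        exp (↑(-2 * Real.pi * v * ξ) * I)).aestronglyMeasurable
    refine hK.bdd_smul 1 hm (Filter.Eventually.of_forall fun v => ?_)
    rw [norm_exp_ofReal_mul_I]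
  have h1 := fourier_comp_sub_right H ℓ ξ
  rw [sub_mul, one_mul, mul_assoc, ← h1]
  simp only [Real.fourier_real_eq_integral_exp_smul]
  rw [← integral_const_mul, ← integral_sub (key _ hH) ((key _ hH').const_mul c)]
  apply integral_congr_ae
  filter_upwards with v
  simp only [smul_eq_mul]
  ring

open MeasureTheory in
theorem integrable_inv_one_add_mul_sq {c : ℝ} (hc : 0 < c) :
    Integrable (fun ξ : ℝ => (1 + (c * ξ) ^ 2)⁻¹) ∧
      ∫ ξ : ℝ, (1 + (c * ξ) ^ 2)⁻¹ = Real.pi / c := by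
  constructor
  · exact integrable_inv_one_add_sq.comp_mul_left' hc.ne'
  · rw [Measure.integral_comp_mul_left (fun x => (1 + x ^ 2)⁻¹) c, integral_univ_inv_one_add_sq,
      abs_of_pos (inv_pos.2 hc), smul_eq_mul]
    field_simp

theorem integrable_sq_of_norm_sq_ofReal {g : ℝ → ℝ} :
    (fun u => ‖((g u : ℝ) : ℂ)‖ ^ 2) = fun u => g u ^ 2 := by
  funext u
  rw [Complex.norm_real, Real.norm_eq_abs, sq_abs]

theorem abs_logMeanDiff_mul_log_le {f : ℕ → ℝ} (hf : ∀ n, |f n| ≤ 1) {ℓ u : ℝ} (hℓ : 0 ≤ ℓ)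
    (hu : 0 ≤ u) : |logMeanDiff (fun n => f n * Real.log n) ℓ u| ≤ 2 * u := by
  have h1 := abs_logMean_mul_log_le hf hu
  have h2 : |logMean (fun n => f n * Real.log n) (u - ℓ)| ≤ u := by
    rcases lt_or_ge (u - ℓ) 0 with h | h
    · rw [logMean_of_neg _ h]; simpa using hu
    · exact (abs_logMean_mul_log_le hf h).trans (by linarith)
  refine (abs_sub _ _).trans ?_
  linarith

theorem le_exp_half_mul {α : ℝ} (hα : 0 < α) (u : ℝ) :
    u ≤ 2 / α * Real.exp (α / 2 * u) := by
  have := Real.add_one_le_exp (α / 2 * u)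
  calc u = 2 / α * (α / 2 * u) := by field_simp
    _ ≤ _ := by gcongr; linarith

open MeasureTheory FourierTransform Complex in
theorem fourier_logMeanDiff_mul_log {f : ℕ →*₀ ℝ} (hf : ∀ n, |f n| ≤ 1) {α ℓ : ℝ} (hα : 0 < α)
    (ξ : ℝ) :
    𝓕 (fun u : ℝ => ((logMeanDiff (fun n => f n * Real.log n) ℓ u *
        Real.exp (-(α * u)) : ℝ) : ℂ)) ξ =
      (1 - exp (-(ℓ * (α + (2 * Real.pi * ξ : ℝ) * I)))) *
      (LSeries (fun n => ((f n * Real.log n : ℝ) : ℂ)) (1 + α + (2 * Real.pi * ξ : ℝ) * I) /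
        (1 + α + (2 * Real.pi * ξ : ℝ) * I)) := by
  have hint := (integrable_memLp_mul_exp (B := 2 / α) hα
    (measurable_logMean (fun n => f n * Real.log n))
    (fun u hu => logMean_of_neg _ hu) (fun u hu => (abs_logMean_mul_log_le hf hu).trans
      (le_exp_half_mul hα u))).1
  rw [← fourier_logMean_mul_exp (a := fun n => f n * Real.log n) (r := 1 + α / 2) (by positivity)
    (by linarith) ξ (LSeriesSummable_mul_log hf hα _) (isBigO_sum_mul_log hf (half_pos hα))]
  have h := fourier_sub_const_mul_comp_sub hint (Real.exp (-(α * ℓ)) : ℝ) ℓ ξ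
  have e1 : ((Real.exp (-(α * ℓ)) : ℝ) : ℂ) * exp (-(2 * Real.pi * ξ * ℓ * I)) =
      exp (-(ℓ * (α + (2 * Real.pi * ξ : ℝ) * I))) := by
    push_cast
    rw [← Complex.exp_add]
    ring_nf
  rw [e1] at h
  rw [← h]
  refine congrArg (fun F : ℝ → ℂ => 𝓕 F ξ) ?_
  funext u
  rw [logMeanDiff]
  push_cast
  have e2 : exp (-(α * u : ℂ)) = exp (-(α * ℓ : ℂ)) * exp (-(α * (u - ℓ) : ℂ)) := by
    rw [← Complex.exp_add]; ring_nf
  rw [e2]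
  ring

open MeasureTheory FourierTransform Complex in
theorem exists_integral_logMeanDiff_sq_le :
    ∃ C : ℝ, 0 < C ∧ ∀ f : ℕ →*₀ ℝ, (∀ n, |f n| ≤ 1) → ∀ α ℓ : ℝ, 0 < α → α ≤ 1 → 0 ≤ ℓ →
      Integrable (fun u =>
        (logMeanDiff (fun n => f n * Real.log n) ℓ u * Real.exp (-(α * u))) ^ 2) ∧
      ∫ u, (logMeanDiff (fun n => f n * Real.log n) ℓ u * Real.exp (-(α * u))) ^ 2 ≤
        C * α ^ (-2.4 : ℝ) * (2 + ℓ) ^ 2 := by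
  obtain ⟨C₁, hC₁, hF⟩ := exists_norm_LSeries_mul_le
  obtain ⟨C₂, hC₂, hL⟩ := exists_norm_LSeries_mul_log_le
  refine ⟨C₁ ^ 2 * 18 + 4 * C₂ ^ 2, by positivity, fun f hf α ℓ hα hα1 hℓ => ?_⟩
  obtain ⟨hi, hm⟩ := integrable_memLp_mul_exp (B := 2 * (2 / α)) hα
    (measurable_logMeanDiff (fun n => f n * Real.log n) ℓ)
    (fun u hu => logMeanDiff_of_neg _ hℓ hu) (fun u hu => (abs_logMeanDiff_mul_log_le hf hℓ hu).trans
      (by rw [mul_assoc]; gcongr; exact le_exp_half_mul hα u))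
  obtain ⟨hpi, hpe⟩ := plancherel_integral hi hm
  have hsq := (memLp_two_iff_integrable_sq_norm hm.1).1 hm
  rw [integrable_sq_of_norm_sq_ofReal] at hsq hpe
  refine ⟨hsq, ?_⟩
  rw [← hpe]
  set P : ℝ → ℂ := fun u => ((logMean (fun n => ArithmeticFunction.vonMangoldt n * f n) u *
    Real.exp (-(α * u)) : ℝ) : ℂ) with hP
  obtain ⟨hPi, hPm⟩ := integrable_memLp_mul_exp (B := 6) hα
    (measurable_logMean (fun n => ArithmeticFunction.vonMangoldt n * f n))
    (fun u hu => logMean_of_neg _ hu) (fun u hu => (abs_logMean_vonMangoldt_mul_le hf u).trans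
      (by
        have := Real.one_le_exp (show 0 ≤ α / 2 * u by positivity)
        linarith))
  obtain ⟨hPpi, hPpe⟩ := plancherel_integral hPi hPm
  have hPsq : Integrable (fun u => ‖P u‖ ^ 2) := (memLp_two_iff_integrable_sq_norm hPm.1).1 hPm
  change Integrable (fun y => ‖𝓕 P y‖ ^ 2) at hPpi
  change ∫ y, ‖𝓕 P y‖ ^ 2 = ∫ u, ‖P u‖ ^ 2 at hPpe
  have hPint : ∫ u, ‖P u‖ ^ 2 ≤ 18 / α := by
    have h36 : ∀ u, ‖P u‖ ^ 2 ≤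
        Set.indicator (Set.Ici (0 : ℝ)) (fun u => 36 * Real.exp (-(2 * α) * u)) u := by
      intro u
      rw [hP]
      simp only [norm_real, Real.norm_eq_abs, sq_abs]
      by_cases hu : 0 ≤ u
      · rw [Set.indicator_of_mem (Set.mem_Ici.2 hu), mul_pow, ← Real.exp_nat_mul]
        have h6 : logMean (fun n => ArithmeticFunction.vonMangoldt n * f n) u ^ 2 ≤ 36 := by
          rw [← sq_abs]
          have := abs_logMean_vonMangoldt_mul_le hf u
          nlinarith [abs_nonneg (logMean (fun n => ArithmeticFunction.vonMangoldt n * f n) u)]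
        have e : ((2 : ℕ) : ℝ) * -(α * u) = -(2 * α) * u := by push_cast; ring
        rw [e]
        gcongr
      · rw [Set.indicator_of_notMem (by simpa using hu), logMean_of_neg _ (not_le.1 hu)]
        simp
    have hint : IntegrableOn (fun u => 36 * Real.exp (-(2 * α) * u)) (Set.Ici 0) := by
      rw [integrableOn_Ici_iff_integrableOn_Ioi]
      exact (integrableOn_exp_mul_Ioi (by linarith) 0).const_mul 36
    calc ∫ u, ‖P u‖ ^ 2 ≤ ∫ u, Set.indicator (Set.Ici (0 : ℝ))
          (fun u => 36 * Real.exp (-(2 * α) * u)) u :=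
          integral_mono hPsq (hint.integrable_indicator measurableSet_Ici) h36
      _ = 18 / α := by
          rw [integral_indicator measurableSet_Ici, integral_Ici_eq_integral_Ioi,
            integral_const_mul, integral_exp_mul_Ioi (by linarith)]
          simp only [mul_zero, Real.exp_zero]
          field_simp
          norm_num
  set T : ℝ := α ^ (-4 : ℝ) with hT
  have hT0 : 0 < T := by positivity
  set c : ℝ := 2 * Real.pi / T with hc
  have hc0 : 0 < c := by positivity
  obtain ⟨hci, hce⟩ := integrable_inv_one_add_mul_sq hc0
  have hpt : ∀ ξ : ℝ, ‖𝓕 (fun u : ℝ => ((logMeanDiff (fun n => f n * Real.log n) ℓ u *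
        Real.exp (-(α * u)) : ℝ) : ℂ)) ξ‖ ^ 2 ≤
      (C₁ * α ^ (-0.7 : ℝ) * (2 + ℓ)) ^ 2 * ‖𝓕 P ξ‖ ^ 2 +
        8 * (C₂ / α ^ 2) ^ 2 / T ^ 2 * (1 + (c * ξ) ^ 2)⁻¹ := by
    intro ξ
    rw [fourier_logMeanDiff_mul_log hf hα]
    set t : ℝ := 2 * Real.pi * ξ with ht
    have hsre : (1 + (α : ℂ) + t * I).re = 1 + α := by simp
    rcases le_or_gt |t| T with h | h
    · have h1 := hF f hf α t ℓ hα hα1 hℓ h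
      have e : 𝓕 P ξ = LSeries (fun n => ((ArithmeticFunction.vonMangoldt n * f n : ℝ) : ℂ))
          (1 + α + t * I) / (1 + α + t * I) :=
        fourier_logMean_mul_exp zero_le_one (by linarith) ξ
          (LSeriesSummable_vonMangoldt_mul hf (by rw [hsre]; linarith))
          (isBigO_sum_vonMangoldt_mul hf)
      rw [LSeries_mul_log_eq hf (by rw [hsre]; linarith)]
      refine le_add_of_le_of_nonneg ?_ (by positivity)
      rw [← mul_pow]
      gcongr
      rw [mul_div_right_comm, ← e, mul_comm, mul_assoc, norm_mul, mul_comm]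
      gcongr
      rw [norm_mul]
      exact h1
    · refine le_add_of_nonneg_of_le (by positivity) ?_
      have hre : 0 ≤ ((ℓ : ℂ) * (α + t * I)).re := by simp; positivity
      have h2 := (norm_one_sub_exp_neg_le hre).2
      have h3 := hL f hf α t hα hα1
      have h4 : |t| ≤ ‖1 + (α : ℂ) + t * I‖ := by
        have := abs_im_le_norm (1 + (α : ℂ) + t * I)
        simpa using this
      have ht0 : 0 < |t| := hT0.trans h
      have ht0' : 0 < t ^ 2 := by rw [← sq_abs t]; positivity
      have h5 : ‖(1 - exp (-(ℓ * (α + t * I)))) *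
          (LSeries (fun n => ((f n * Real.log n : ℝ) : ℂ)) (1 + α + t * I) / (1 + α + t * I))‖ ≤
          2 * (C₂ / α ^ 2 / |t|) := by
        rw [norm_mul, norm_div]
        gcongr
      calc _ ≤ (2 * (C₂ / α ^ 2 / |t|)) ^ 2 := by gcongr
        _ = 4 * (C₂ / α ^ 2) ^ 2 * (1 / t ^ 2) := by
          rw [mul_pow, div_pow _ |t|, sq_abs]; ring
        _ ≤ 4 * (C₂ / α ^ 2) ^ 2 * (2 / T ^ 2 * (1 + (c * ξ) ^ 2)⁻¹) := by
          gcongr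
          have e : c * ξ = t / T := by rw [hc, ht]; ring
          have hTt : T ^ 2 ≤ t ^ 2 := by rw [← sq_abs t]; gcongr
          rw [e, ← div_eq_mul_inv, div_div, div_le_div_iff₀ (by positivity) (by positivity)]
          have : T ^ 2 * (1 + (t / T) ^ 2) = T ^ 2 + t ^ 2 := by field_simp
          rw [this]; linarith
        _ = _ := by ring
  have hI1 := hPpi.const_mul ((C₁ * α ^ (-0.7 : ℝ) * (2 + ℓ)) ^ 2)
  have hI2 := hci.const_mul (8 * (C₂ / α ^ 2) ^ 2 / T ^ 2)
  have hα24 : 1 ≤ α ^ (-2.4 : ℝ) :=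
    Real.one_le_rpow_of_pos_of_le_one_of_nonpos hα hα1 (by norm_num)
  calc _ ≤ ∫ ξ, ((C₁ * α ^ (-0.7 : ℝ) * (2 + ℓ)) ^ 2 * ‖𝓕 P ξ‖ ^ 2 +
        8 * (C₂ / α ^ 2) ^ 2 / T ^ 2 * (1 + (c * ξ) ^ 2)⁻¹) := integral_mono hpi (hI1.add hI2) hpt
    _ = (C₁ * α ^ (-0.7 : ℝ) * (2 + ℓ)) ^ 2 * (∫ u, ‖P u‖ ^ 2) +
        8 * (C₂ / α ^ 2) ^ 2 / T ^ 2 * (Real.pi / c) := by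
          rw [integral_add hI1 hI2, integral_const_mul, integral_const_mul, hPpe, hce]
    _ ≤ (C₁ * α ^ (-0.7 : ℝ) * (2 + ℓ)) ^ 2 * (18 / α) +
        8 * (C₂ / α ^ 2) ^ 2 / T ^ 2 * (Real.pi / c) := by gcongr
    _ = C₁ ^ 2 * 18 * α ^ (-2.4 : ℝ) * (2 + ℓ) ^ 2 + 4 * C₂ ^ 2 := by
          have e1 : (α ^ (-0.7 : ℝ)) ^ 2 / α = α ^ (-2.4 : ℝ) := by
            rw [← Real.rpow_mul_natCast hα.le, ← Real.rpow_sub_one hα.ne']; norm_num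
          have e2 : T = (α ^ 4)⁻¹ := by
            rw [hT, Real.rpow_neg hα.le]; norm_cast
          have e3 : 8 * (C₂ / α ^ 2) ^ 2 / T ^ 2 * (Real.pi / c) = 4 * C₂ ^ 2 := by
            rw [hc, e2]
            have := Real.pi_pos
            field_simp
            ring
          rw [e3, ← e1]
          ring
    _ ≤ _ := by
          rw [add_mul, add_mul]
          have : 1 ≤ (2 + ℓ) ^ 2 := by nlinarith
          have h7 : 1 ≤ α ^ (-2.4 : ℝ) * (2 + ℓ) ^ 2 := one_le_mul_of_one_le_of_one_le hα24 this
          have h8 : 0 ≤ 4 * C₂ ^ 2 := by positivity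
          nlinarith

open MeasureTheory in
theorem integrableOn_logMeanDiff_sq {f : ℕ → ℝ} (hf : ∀ n, |f n| ≤ 1) (ℓ : ℝ) {s : Set ℝ}
    (hs : volume s ≠ ⊤) : IntegrableOn (fun u => logMeanDiff f ℓ u ^ 2) s := by
  refine Measure.integrableOn_of_bounded (M := 4) hs
    ((measurable_logMeanDiff f ℓ).pow_const 2).aestronglyMeasurable
    (Filter.Eventually.of_forall fun u => ?_)
  have := abs_logMeanDiff_le_two hf ℓ u
  rw [Real.norm_eq_abs, abs_pow]
  nlinarith [abs_nonneg (logMeanDiff f ℓ u)]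

open MeasureTheory in
theorem exists_integral_Ioc_half_logMeanDiff_sq_le :
    ∃ C : ℝ, 0 < C ∧ ∀ f : ℕ →*₀ ℝ, (∀ n, |f n| ≤ 1) → ∀ ℓ U : ℝ, 0 ≤ ℓ → 1 ≤ U →
      ∫ u in Set.Ioc (U / 2) U, logMeanDiff f ℓ u ^ 2 ≤ C * U ^ (0.4 : ℝ) * (2 + ℓ) ^ 2 := by
  obtain ⟨C, hC, hJ⟩ := exists_integral_logMeanDiff_sq_le
  refine ⟨72 * C + 4, by positivity, fun f hf ℓ U hℓ hU => ?_⟩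
  have hU0 : 0 < U := by linarith
  obtain ⟨hi, hb⟩ := hJ f hf (1 / U) ℓ (by positivity) (by rw [div_le_one hU0]; exact hU) hℓ
  set g : ℝ → ℝ := fun u =>
    (logMeanDiff (fun n => f n * Real.log n) ℓ u * Real.exp (-(1 / U * u))) ^ 2 with hg
  have hpt : ∀ u ∈ Set.Ioc (U / 2) U, logMeanDiff f ℓ u ^ 2 ≤
      72 / U ^ 2 * g u + 8 / U ^ 2 * (2 + ℓ) ^ 2 := by
    intro u hu
    have hu0 : 0 < u := by linarith [hu.1]
    have h1 := abs_le.1 (abs_logMeanDiff_mul_log_sub_le hf hℓ u)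
    set E := logMeanDiff (fun n => f n * Real.log n) ℓ u with hE
    set φ := logMeanDiff f ℓ u
    have h2 : (u * φ) ^ 2 ≤ 2 * E ^ 2 + 2 * (2 + ℓ) ^ 2 := by
      have : (E - u * φ) ^ 2 ≤ (2 + ℓ) ^ 2 := sq_le_sq' h1.1 h1.2
      nlinarith [sq_nonneg (2 * E - u * φ)]
    have h3 : E ^ 2 ≤ 9 * g u := by
      have e1 : g u = E ^ 2 * (Real.exp (-(1 / U * u))) ^ 2 := by rw [hg, ← mul_pow]
      have e2 : 1 / 3 ≤ Real.exp (-(1 / U * u)) := by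
        have : -1 ≤ -(1 / U * u) := by
          have : 1 / U * u ≤ 1 := by rw [one_div, inv_mul_le_iff₀ hU0]; linarith [hu.2]
          linarith
        refine le_trans ?_ (Real.exp_le_exp.2 this)
        rw [Real.exp_neg, ← one_div]
        exact one_div_le_one_div_of_le (Real.exp_pos 1) (by linarith [Real.exp_one_lt_d9])
      have e3 : (1 / 3 : ℝ) ^ 2 ≤ (Real.exp (-(1 / U * u))) ^ 2 := by gcongr
      rw [e1]
      nlinarith [sq_nonneg E]
    have h4 : U ^ 2 / 4 * φ ^ 2 ≤ (u * φ) ^ 2 := by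
      rw [mul_pow]
      have : U ^ 2 / 4 ≤ u ^ 2 := by nlinarith [hu.1]
      gcongr
    have h5 : U ^ 2 * φ ^ 2 ≤ 72 * g u + 8 * (2 + ℓ) ^ 2 := by linarith
    calc φ ^ 2 = U ^ 2 * φ ^ 2 / U ^ 2 := by field_simp
      _ ≤ (72 * g u + 8 * (2 + ℓ) ^ 2) / U ^ 2 := by gcongr
      _ = _ := by ring
  have hvol : volume (Set.Ioc (U / 2) U) ≠ ⊤ := by simp
  have hc : IntegrableOn (fun _ : ℝ => 8 / U ^ 2 * (2 + ℓ) ^ 2) (Set.Ioc (U / 2) U) :=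
    integrableOn_const hvol
  have hgi : IntegrableOn (fun u => 72 / U ^ 2 * g u) (Set.Ioc (U / 2) U) :=
    (hi.const_mul _).integrableOn
  have hgle : ∫ u in Set.Ioc (U / 2) U, g u ≤ ∫ u, g u :=
    setIntegral_le_integral hi (Filter.Eventually.of_forall fun u => sq_nonneg _)
  have hinv : (1 / U) ^ (-2.4 : ℝ) = U ^ 2 * U ^ (0.4 : ℝ) := by
    rw [one_div, Real.inv_rpow hU0.le, Real.rpow_neg hU0.le, inv_inv, ← Real.rpow_natCast,
      ← Real.rpow_add hU0]
    norm_num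
  rw [hinv] at hb
  have hU4 : 1 ≤ U ^ (0.4 : ℝ) := Real.one_le_rpow hU (by norm_num)
  calc ∫ u in Set.Ioc (U / 2) U, logMeanDiff f ℓ u ^ 2
      ≤ ∫ u in Set.Ioc (U / 2) U, (72 / U ^ 2 * g u + 8 / U ^ 2 * (2 + ℓ) ^ 2) :=
        setIntegral_mono_on (integrableOn_logMeanDiff_sq hf ℓ hvol) (hgi.add hc)
          measurableSet_Ioc hpt
    _ = 72 / U ^ 2 * (∫ u in Set.Ioc (U / 2) U, g u) + U / 2 * (8 / U ^ 2 * (2 + ℓ) ^ 2) := by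
        rw [integral_add hgi hc, integral_const_mul, setIntegral_const]
        rw [Measure.real, Real.volume_Ioc, ENNReal.toReal_ofReal (by linarith), smul_eq_mul]
        ring
    _ ≤ 72 / U ^ 2 * (C * (U ^ 2 * U ^ (0.4 : ℝ)) * (2 + ℓ) ^ 2) +
        U / 2 * (8 / U ^ 2 * (2 + ℓ) ^ 2) := by
        gcongr
        exact hgle.trans hb
    _ = 72 * C * U ^ (0.4 : ℝ) * (2 + ℓ) ^ 2 + 4 * (1 / U) * (2 + ℓ) ^ 2 := by
        field_simp
        ring
    _ ≤ 72 * C * U ^ (0.4 : ℝ) * (2 + ℓ) ^ 2 + 4 * U ^ (0.4 : ℝ) * (2 + ℓ) ^ 2 := by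
        gcongr
        exact le_trans (by rw [div_le_one hU0]; exact hU) hU4
    _ = _ := by ring

open MeasureTheory in
theorem exists_integral_Ioc_logMeanDiff_sq_le :
    ∃ C : ℝ, 0 < C ∧ ∀ f : ℕ →*₀ ℝ, (∀ n, |f n| ≤ 1) → ∀ ℓ U : ℝ, 0 ≤ ℓ → 0 < U →
      ∫ u in Set.Ioc 0 U, logMeanDiff f ℓ u ^ 2 ≤ C * U ^ (0.4 : ℝ) * (2 + ℓ) ^ 2 := by
  obtain ⟨K, hK, hJ⟩ := exists_integral_Ioc_half_logMeanDiff_sq_le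
  refine ⟨5 * K + 4, by positivity, fun f hf ℓ U hℓ hU => ?_⟩
  have hvol : ∀ a b : ℝ, volume (Set.Ioc a b) ≠ ⊤ := by simp
  have key : ∀ n : ℕ, ∀ U : ℝ, 0 < U → U ≤ 2 ^ n →
      ∫ u in Set.Ioc 0 U, logMeanDiff f ℓ u ^ 2 ≤ (5 * K + 4) * U ^ (0.4 : ℝ) * (2 + ℓ) ^ 2 := by
    have hsmall : ∀ U : ℝ, 0 < U → U ≤ 1 → ∫ u in Set.Ioc 0 U, logMeanDiff f ℓ u ^ 2 ≤
        (5 * K + 4) * U ^ (0.4 : ℝ) * (2 + ℓ) ^ 2 := by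
      intro U hU hU1
      have h1 : ∫ u in Set.Ioc 0 U, logMeanDiff f ℓ u ^ 2 ≤ ∫ u in Set.Ioc 0 U, (4 : ℝ) := by
        refine setIntegral_mono_on (integrableOn_logMeanDiff_sq hf ℓ (hvol _ _))
          (integrableOn_const (hvol _ _)) measurableSet_Ioc fun u _ => ?_
        have := abs_logMeanDiff_le_two hf ℓ u
        rw [← sq_abs]
        nlinarith [abs_nonneg (logMeanDiff f ℓ u)]
      rw [setIntegral_const, Measure.real, Real.volume_Ioc, ENNReal.toReal_ofReal (by linarith),
        smul_eq_mul] at h1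
      have h2 : U ≤ U ^ (0.4 : ℝ) := by
        simpa using Real.rpow_le_rpow_of_exponent_ge hU hU1 (show (0.4 : ℝ) ≤ 1 by norm_num)
      have h3 : 1 ≤ (2 + ℓ) ^ 2 := by nlinarith
      calc _ ≤ (U - 0) * 4 := h1
        _ ≤ 4 * U ^ (0.4 : ℝ) * 1 := by linarith
        _ ≤ _ := by gcongr; linarith
    intro n
    induction n with
    | zero => intro U hU hU1; exact hsmall U hU (by simpa using hU1)
    | succ n ih =>
      intro U hU hUn
      rcases le_or_gt U 1 with h | h
      · exact hsmall U hU h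
      have h1 := ih (U / 2) (by linarith) (by rw [pow_succ] at hUn; linarith)
      have h2 := hJ f hf ℓ U hℓ h.le
      have h3 : Set.Ioc 0 U = Set.Ioc 0 (U / 2) ∪ Set.Ioc (U / 2) U :=
        (Set.Ioc_union_Ioc_eq_Ioc (by linarith) (by linarith)).symm
      rw [h3, setIntegral_union (Set.Ioc_disjoint_Ioc_of_le le_rfl) measurableSet_Ioc
        (integrableOn_logMeanDiff_sq hf ℓ (hvol _ _)) (integrableOn_logMeanDiff_sq hf ℓ (hvol _ _))]
      have h4 : (U / 2) ^ (0.4 : ℝ) ≤ 0.8 * U ^ (0.4 : ℝ) := by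
        rw [Real.div_rpow hU.le (by norm_num), div_eq_inv_mul]
        gcongr
        rw [inv_le_comm₀ (by positivity) (by norm_num)]
        have : ((0.8 : ℝ)⁻¹ ^ (2.5 : ℝ)) ^ (0.4 : ℝ) ≤ 2 ^ (0.4 : ℝ) := by
          gcongr
          have e : ((0.8 : ℝ)⁻¹ ^ (2.5 : ℝ)) ≤ (0.8 : ℝ)⁻¹ ^ (3 : ℝ) :=
            Real.rpow_le_rpow_of_exponent_le (by norm_num) (by norm_num)
          refine e.trans ?_
          norm_num
        rw [← Real.rpow_mul (by norm_num)] at this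
        norm_num at this ⊢
        exact this
      calc _ ≤ (5 * K + 4) * (0.8 * U ^ (0.4 : ℝ)) * (2 + ℓ) ^ 2 +
            K * U ^ (0.4 : ℝ) * (2 + ℓ) ^ 2 := by
            refine add_le_add (h1.trans ?_) h2
            gcongr
        _ = (5 * K + 3.2) * U ^ (0.4 : ℝ) * (2 + ℓ) ^ 2 := by ring
        _ ≤ _ := by gcongr; norm_num
  obtain ⟨n, hn⟩ := pow_unbounded_of_one_lt U (one_lt_two)
  exact key n U hU hn.le

theorem abs_logMean_add_sub_le {f : ℕ → ℝ} (hf : ∀ n, |f n| ≤ 1) (w : ℝ) {v : ℝ} (hv : 0 ≤ v) :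
    |logMean f (w + v) - logMean f w| ≤ 2 * v + Real.exp (-w) := by
  set N := ⌊Real.exp w⌋₊ with hN
  set N' := ⌊Real.exp (w + v)⌋₊ with hN'
  have hNN : N ≤ N' := Nat.floor_le_floor (Real.exp_le_exp.2 (by linarith))
  have hS : ∑ n ∈ Finset.Icc 1 N', f n = ∑ n ∈ Finset.Icc 1 N, f n + ∑ n ∈ Finset.Ioc N N', f n := by
    have e : ∀ M : ℕ, Finset.Icc 1 M = Finset.Ioc 0 M := fun M => by ext; simp; omega
    rw [e, e, Finset.sum_Ioc_consecutive _ (Nat.zero_le _) hNN]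
  have h1 : |∑ n ∈ Finset.Ioc N N', f n| ≤ Real.exp (w + v) - Real.exp w + 1 := by
    refine (Finset.abs_sum_le_sum_abs _ _).trans
      ((Finset.sum_le_card_nsmul _ _ _ fun n _ => hf n).trans ?_)
    rw [nsmul_eq_mul, Nat.card_Ioc, Nat.cast_sub hNN, mul_one]
    have a1 := Nat.floor_le (Real.exp_pos (w + v)).le
    have a2 := Nat.lt_floor_add_one (Real.exp w)
    rw [← hN'] at a1
    rw [← hN] at a2
    linarith
  have h2 : |logMean f w| ≤ 1 := abs_logMean_le zero_le_one fun n _ => hf n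
  have h3 : logMean f (w + v) - logMean f w =
      Real.exp (-(w + v)) * ∑ n ∈ Finset.Ioc N N', f n - (1 - Real.exp (-v)) * logMean f w := by
    rw [logMean, logMean, ← hN, ← hN', hS, neg_add, Real.exp_add]
    ring
  have h4 : 1 - Real.exp (-v) ≤ v := by linarith [Real.add_one_le_exp (-v)]
  have h5 : 0 ≤ 1 - Real.exp (-v) := by
    linarith [Real.exp_le_one_iff.2 (show -v ≤ 0 by linarith)]
  have h6 : Real.exp (-(w + v)) * (Real.exp (w + v) - Real.exp w + 1) =
      (1 - Real.exp (-v)) + Real.exp (-(w + v)) := by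
    have a1 : Real.exp (-(w + v)) * Real.exp (w + v) = 1 := by rw [← Real.exp_add]; simp
    have a2 : Real.exp (-(w + v)) * Real.exp w = Real.exp (-v) := by
      rw [← Real.exp_add]; ring_nf
    linear_combination a1 - a2
  have h7 : Real.exp (-(w + v)) ≤ Real.exp (-w) := Real.exp_le_exp.2 (by linarith)
  rw [h3]
  calc _ ≤ |Real.exp (-(w + v)) * ∑ n ∈ Finset.Ioc N N', f n| +
        |(1 - Real.exp (-v)) * logMean f w| := abs_sub _ _
    _ ≤ Real.exp (-(w + v)) * (Real.exp (w + v) - Real.exp w + 1) + (1 - Real.exp (-v)) * 1 := by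
        rw [abs_mul, abs_mul, abs_of_pos (Real.exp_pos _), abs_of_nonneg h5]
        gcongr
    _ ≤ _ := by rw [h6]; linarith

theorem abs_logMeanDiff_add_sub_le {f : ℕ → ℝ} (hf : ∀ n, |f n| ≤ 1) {ℓ U v : ℝ} (hℓ : 0 ≤ ℓ)
    (hU : ℓ ≤ U / 2) (hv : 0 ≤ v) :
    |logMeanDiff f ℓ (U + v) - logMeanDiff f ℓ U| ≤ 4 * v + 2 * Real.exp (-(U / 2)) := by
  have h1 := abs_logMean_add_sub_le hf U hv
  have h2 := abs_logMean_add_sub_le hf (U - ℓ) hv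
  have h3 : Real.exp (-U) ≤ Real.exp (-(U / 2)) := Real.exp_le_exp.2 (by linarith)
  have h4 : Real.exp (-(U - ℓ)) ≤ Real.exp (-(U / 2)) := Real.exp_le_exp.2 (by linarith)
  rw [logMeanDiff, logMeanDiff, show U + v - ℓ = U - ℓ + v by ring]
  calc _ = |(logMean f (U + v) - logMean f U) - (logMean f (U - ℓ + v) - logMean f (U - ℓ))| := by
        ring_nf
    _ ≤ _ := (abs_sub _ _).trans (by linarith)

theorem sum_vonMangoldt_div_indicator_le (K : ℕ) (y : ℝ) {h : ℝ} (hh : h ≤ 1) :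
    ∑ k ∈ Finset.Icc 1 K, ArithmeticFunction.vonMangoldt k / k *
      (Set.Icc y (y + h)).indicator 1 (Real.log k) ≤ 18 := by
  have h1 := (le_abs_self _).trans
    (abs_sum_vonMangoldt_mul_le (f := 1) (x := Real.exp (y + h)) (by simp) (Real.exp_pos _).le)
  simp only [Pi.one_apply, mul_one] at h1
  calc _ ≤ ∑ k ∈ Finset.Icc 1 K, Real.exp (-y) *
        ((Finset.Icc 1 ⌊Real.exp (y + h)⌋₊ : Set ℕ).indicator ArithmeticFunction.vonMangoldt k) := by
        refine Finset.sum_le_sum fun k hk => ?_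
        rw [Finset.mem_Icc] at hk
        have hk0 : (0 : ℝ) < k := by exact_mod_cast hk.1
        by_cases hm : Real.log k ∈ Set.Icc y (y + h)
        · have hk' : k ∈ (Finset.Icc 1 ⌊Real.exp (y + h)⌋₊ : Set ℕ) := by
            rw [Finset.mem_coe, Finset.mem_Icc]
            refine ⟨hk.1, Nat.le_floor ?_⟩
            rw [← Real.log_le_iff_le_exp hk0]
            exact hm.2
          rw [Set.indicator_of_mem hm, Set.indicator_of_mem hk', Pi.one_apply, mul_one,
            div_eq_inv_mul]
          gcongr
          rw [Real.exp_neg]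
          gcongr
          rw [← Real.le_log_iff_exp_le hk0]
          exact hm.1
        · rw [Set.indicator_of_notMem hm, mul_zero]
          exact mul_nonneg (Real.exp_pos _).le
            (Set.indicator_nonneg (fun _ _ => ArithmeticFunction.vonMangoldt_nonneg) _)
    _ ≤ Real.exp (-y) * ∑ k ∈ Finset.Icc 1 ⌊Real.exp (y + h)⌋₊, ArithmeticFunction.vonMangoldt k := by
        rw [← Finset.mul_sum]
        gcongr
        classical
        simp only [Set.indicator_apply, Finset.mem_coe]
        rw [← Finset.sum_filter]
        exact Finset.sum_le_sum_of_subset_of_nonneg (fun k hk => (Finset.mem_filter.1 hk).2)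
          fun _ _ _ => ArithmeticFunction.vonMangoldt_nonneg
    _ ≤ Real.exp (-y) * (6 * Real.exp (y + h)) := by gcongr
    _ = 6 * Real.exp h := by
        rw [mul_left_comm, ← Real.exp_add]
        ring_nf
    _ ≤ 6 * Real.exp 1 := by gcongr
    _ ≤ 18 := by linarith [Real.exp_one_lt_d9]

open MeasureTheory in
theorem sum_vonMangoldt_div_integral_sq_le {f : ℕ → ℝ} (hf : ∀ n, |f n| ≤ 1) {ℓ : ℝ} (hℓ : 0 ≤ ℓ)
    (U : ℝ) {h : ℝ} (hh : h ≤ 1) (K : ℕ) :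
    ∑ k ∈ Finset.Icc 1 K, ArithmeticFunction.vonMangoldt k / k *
      ∫ v in Set.Ioc 0 h, logMeanDiff f ℓ (U + v - Real.log k) ^ 2 ≤
    18 * ∫ u in Set.Ioc 0 (U + 1), logMeanDiff f ℓ u ^ 2 := by
  have hint : ∀ s : Set ℝ, MeasurableSet s → volume s ≠ ⊤ →
      Integrable (s.indicator fun u => logMeanDiff f ℓ u ^ 2) := fun s hs hs' =>
    (integrableOn_logMeanDiff_sq hf ℓ hs').integrable_indicator hs
  have hshift : ∀ k : ℕ, ∫ v in Set.Ioc 0 h, logMeanDiff f ℓ (U + v - Real.log k) ^ 2 =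
      ∫ u, (Set.Ioc (U - Real.log k) (U - Real.log k + h)).indicator
        (fun u => logMeanDiff f ℓ u ^ 2) u := by
    intro k
    rw [← integral_indicator measurableSet_Ioc, ← integral_add_right_eq_self ((Set.Ioc (U - Real.log k)
      (U - Real.log k + h)).indicator fun u => logMeanDiff f ℓ u ^ 2) (U - Real.log k)]
    refine integral_congr_ae (Filter.Eventually.of_forall fun v => ?_)
    simp only [Set.indicator_apply, Set.mem_Ioc]
    have : (0 < v ∧ v ≤ h) ↔ (U - Real.log k < v + (U - Real.log k) ∧
        v + (U - Real.log k) ≤ U - Real.log k + h) := by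
      constructor <;> rintro ⟨h1, h2⟩ <;> constructor <;> linarith
    rw [if_congr this rfl rfl, show U + v - Real.log k = v + (U - Real.log k) by ring]
  simp_rw [hshift]
  rw [← integral_indicator measurableSet_Ioc, ← integral_const_mul]
  simp_rw [← integral_const_mul]
  rw [← integral_finsetSum _ fun k _ => ((hint _ measurableSet_Ioc (by simp)).const_mul _)]
  refine integral_mono_ae
    (integrable_finsetSum _ fun k _ => ((hint _ measurableSet_Ioc (by simp)).const_mul _))
    ((hint _ measurableSet_Ioc (by simp)).const_mul _) ?_
  have hne : ∀ᵐ u : ℝ, u ≠ 0 := by simp [ae_iff]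
  filter_upwards [hne] with u hu
  rcases lt_or_gt_of_ne hu with hneg | hpos
  · simp [Set.indicator_apply, logMeanDiff_of_neg f hℓ hneg]
  rcases le_or_gt u (U + 1) with hle | hgt
  · rw [Set.indicator_of_mem (show u ∈ Set.Ioc 0 (U + 1) from ⟨hpos, hle⟩)]
    refine le_trans ?_ (mul_le_mul_of_nonneg_right
      (sum_vonMangoldt_div_indicator_le K (U - u) hh) (sq_nonneg (logMeanDiff f ℓ u)))
    rw [Finset.sum_mul]
    refine Finset.sum_le_sum fun k _ => ?_
    rw [mul_assoc]
    refine mul_le_mul_of_nonneg_left ?_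
      (div_nonneg ArithmeticFunction.vonMangoldt_nonneg k.cast_nonneg)
    by_cases hm : u ∈ Set.Ioc (U - Real.log k) (U - Real.log k + h)
    · rw [Set.indicator_of_mem hm, Set.indicator_of_mem, Pi.one_apply, one_mul]
      constructor <;> linarith [hm.1, hm.2]
    · rw [Set.indicator_of_notMem hm]
      exact mul_nonneg (Set.indicator_nonneg (fun _ _ => zero_le_one) _) (sq_nonneg _)
  · rw [Set.indicator_of_notMem (fun hm => absurd hm.2 (not_le.2 hgt)), mul_zero]
    refine Finset.sum_nonpos fun k hk => ?_
    rw [Set.indicator_of_notMem, mul_zero]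
    rintro ⟨-, h2⟩
    have : 0 ≤ Real.log k := Real.log_natCast_nonneg k
    linarith

open MeasureTheory in
theorem exists_abs_logMeanDiff_le :
    ∃ C : ℝ, 0 < C ∧ ∀ f : ℕ →*₀ ℝ, (∀ n, |f n| ≤ 1) → ∀ ℓ U : ℝ, 1 ≤ U → 0 ≤ ℓ → ℓ ≤ U / 2 →
      |logMeanDiff f ℓ U| ≤ C * (2 + ℓ) * U ^ (-0.2 : ℝ) := by
  obtain ⟨C, hC, hJ⟩ := exists_integral_Ioc_logMeanDiff_sq_le
  refine ⟨20 + 18 * C, by positivity, fun f hf ℓ U hU hℓ hℓU => ?_⟩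
  have hU0 : 0 < U := by linarith
  set h := U ^ (-0.2 : ℝ) with hh
  have hh0 : 0 < h := Real.rpow_pos_of_pos hU0 _
  have hh1 : h ≤ 1 := Real.rpow_le_one_of_one_le_of_nonpos hU (by norm_num)
  set lam := h * (2 + ℓ) with hlam
  have hlam0 : 0 < lam := by positivity
  set K := ⌊Real.exp (U + 1)⌋₊ with hK
  have hK1 : 0 < K := Nat.floor_pos.2 (Real.one_le_exp (by linarith))
  have hsumΛ : ∑ k ∈ Finset.Icc 1 K, ArithmeticFunction.vonMangoldt k / k ≤ 2 * (U + 1) := by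
    refine (sum_vonMangoldt_div_le K).trans ?_
    gcongr
    rw [Real.log_le_iff_le_exp (by exact_mod_cast hK1)]
    exact Nat.floor_le (Real.exp_pos _).le
  set E := 4 * h + 2 * Real.exp (-(U / 2)) with hE
  -- pointwise bound on the window `(0, h]`
  have hpt : ∀ v ∈ Set.Ioc 0 h, U * |logMeanDiff f ℓ U| ≤ lam * (U + 1) + (2 + ℓ) + U * E +
      1 / (2 * lam) * ∑ k ∈ Finset.Icc 1 K, ArithmeticFunction.vonMangoldt k / k *
        logMeanDiff f ℓ (U + v - Real.log k) ^ 2 := by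
    intro v hv
    have h1 := abs_logMeanDiff_add_sub_le hf hℓ hℓU hv.1.le
    have h2 := abs_logMeanDiff_mul_log_sub_le hf hℓ (U + v)
    have h3 := abs_logMeanDiff_mul_log_le_sum hf hℓ (U + v) (K := K)
      (Nat.floor_le_floor (Real.exp_le_exp.2 (by linarith [hv.2])))
    have h4 : ∑ k ∈ Finset.Icc 1 K, ArithmeticFunction.vonMangoldt k / k *
          |logMeanDiff f ℓ (U + v - Real.log k)| ≤
        ∑ k ∈ Finset.Icc 1 K, (ArithmeticFunction.vonMangoldt k / k * (lam / 2) + 1 / (2 * lam) *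
          (ArithmeticFunction.vonMangoldt k / k *
            logMeanDiff f ℓ (U + v - Real.log k) ^ 2)) := by
      refine Finset.sum_le_sum fun k _ => ?_
      have hc : 0 ≤ ArithmeticFunction.vonMangoldt k / k :=
        div_nonneg ArithmeticFunction.vonMangoldt_nonneg k.cast_nonneg
      have : |logMeanDiff f ℓ (U + v - Real.log k)| ≤
          lam / 2 + 1 / (2 * lam) * logMeanDiff f ℓ (U + v - Real.log k) ^ 2 := by
        rw [← sq_abs (logMeanDiff f ℓ (U + v - Real.log k))]
        set z := |logMeanDiff f ℓ (U + v - Real.log k)|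
        have : lam / 2 + 1 / (2 * lam) * z ^ 2 - z = (z - lam) ^ 2 / (2 * lam) := by
          field_simp
          ring
        have : 0 ≤ (z - lam) ^ 2 / (2 * lam) := by positivity
        linarith
      nlinarith [mul_le_mul_of_nonneg_left this hc]
    rw [Finset.sum_add_distrib, ← Finset.sum_mul, ← Finset.mul_sum] at h4
    have h5 : U * |logMeanDiff f ℓ (U + v)| ≤ (2 + ℓ) +
        |logMeanDiff (fun n => f n * Real.log n) ℓ (U + v)| := by
      calc U * |logMeanDiff f ℓ (U + v)| ≤ (U + v) * |logMeanDiff f ℓ (U + v)| := by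
            gcongr; linarith [hv.1]
        _ = |(U + v) * logMeanDiff f ℓ (U + v)| := by
            rw [abs_mul, abs_of_pos (show 0 < U + v by linarith [hv.1])]
        _ ≤ _ := by
            have := abs_sub_abs_le_abs_sub ((U + v) * logMeanDiff f ℓ (U + v))
              (logMeanDiff (fun n => f n * Real.log n) ℓ (U + v))
            rw [abs_sub_comm] at h2
            linarith
    have h6 : |logMeanDiff f ℓ U| ≤ |logMeanDiff f ℓ (U + v)| + E := by
      have := abs_sub_abs_le_abs_sub (logMeanDiff f ℓ U) (logMeanDiff f ℓ (U + v))
      rw [abs_sub_comm (logMeanDiff f ℓ U)] at this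
      linarith [hv.2]
    have h7 := mul_le_mul_of_nonneg_left h6 hU0.le
    have h8 := mul_le_mul_of_nonneg_right hsumΛ (show 0 ≤ lam / 2 by positivity)
    linarith
  -- average over the window
  have hvol : volume (Set.Ioc 0 h) ≠ ⊤ := by simp
  have hint : ∀ k : ℕ, IntegrableOn (fun v => logMeanDiff f ℓ (U + v - Real.log k) ^ 2)
      (Set.Ioc 0 h) := fun k => by
    refine Measure.integrableOn_of_bounded (M := 4) hvol
      (((measurable_logMeanDiff f ℓ).comp (by fun_prop)).pow_const 2).aestronglyMeasurable
      (Filter.Eventually.of_forall fun u => ?_)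
    have := abs_logMeanDiff_le_two hf ℓ (U + u - Real.log k)
    rw [Real.norm_eq_abs, abs_pow]
    nlinarith [abs_nonneg (logMeanDiff f ℓ (U + u - Real.log k))]
  have hvolr : (volume : Measure ℝ).real (Set.Ioc 0 h) = h := by
    rw [Measure.real, Real.volume_Ioc, ENNReal.toReal_ofReal (by linarith), sub_zero]
  have hsumint : IntegrableOn (fun v => ∑ k ∈ Finset.Icc 1 K, ArithmeticFunction.vonMangoldt k / k *
        logMeanDiff f ℓ (U + v - Real.log k) ^ 2) (Set.Ioc 0 h) :=
    integrable_finsetSum _ fun k _ => (hint k).const_mul _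
  have hconst : ∀ c : ℝ, IntegrableOn (fun _ : ℝ => c) (Set.Ioc 0 h) := fun c =>
    integrableOn_const hvol
  have havg := setIntegral_mono_on (hconst _)
    ((hconst _).add (hsumint.const_mul (1 / (2 * lam)))) measurableSet_Ioc hpt
  have e1 : (∫ v in Set.Ioc 0 h, (lam * (U + 1) + (2 + ℓ) + U * E +
      1 / (2 * lam) * ∑ k ∈ Finset.Icc 1 K, ArithmeticFunction.vonMangoldt k / k *
        logMeanDiff f ℓ (U + v - Real.log k) ^ 2)) =
      h * (lam * (U + 1) + (2 + ℓ) + U * E) + 1 / (2 * lam) *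
        ∑ k ∈ Finset.Icc 1 K, ArithmeticFunction.vonMangoldt k / k *
          ∫ v in Set.Ioc 0 h, logMeanDiff f ℓ (U + v - Real.log k) ^ 2 := by
    rw [integral_add (hconst _) (hsumint.const_mul _), setIntegral_const, hvolr,
      smul_eq_mul, integral_const_mul, integral_finsetSum _ fun k _ => (hint k).const_mul _]
    simp_rw [integral_const_mul]
  have hJ' : ∫ u in Set.Ioc 0 (U + 1), logMeanDiff f ℓ u ^ 2 ≤
      C * (2 * U ^ (0.4 : ℝ)) * (2 + ℓ) ^ 2 := by
    refine (hJ f hf ℓ (U + 1) hℓ (by linarith)).trans ?_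
    gcongr
    calc (U + 1) ^ (0.4 : ℝ) ≤ (2 * U) ^ (0.4 : ℝ) := by gcongr; linarith
      _ = 2 ^ (0.4 : ℝ) * U ^ (0.4 : ℝ) := Real.mul_rpow (by norm_num) hU0.le
      _ ≤ 2 * U ^ (0.4 : ℝ) := by
          gcongr
          simpa using Real.rpow_le_rpow_of_exponent_le (show (1 : ℝ) ≤ 2 by norm_num)
            (show (0.4 : ℝ) ≤ 1 by norm_num)
  have hW := (sum_vonMangoldt_div_integral_sq_le hf hℓ U hh1 K).trans
    (mul_le_mul_of_nonneg_left hJ' (by norm_num))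
  simp only [Pi.add_apply] at havg
  rw [e1, setIntegral_const, hvolr, smul_eq_mul] at havg
  have hhU : U ^ (0.4 : ℝ) = U * h ^ 3 := by
    rw [hh, ← Real.rpow_natCast, ← Real.rpow_mul hU0.le]
    nth_rewrite 2 [← Real.rpow_one U]
    rw [← Real.rpow_add hU0]
    norm_num
  have hUh : 1 ≤ U * h := by
    have : U * h = U ^ (0.8 : ℝ) := by
      nth_rewrite 1 [← Real.rpow_one U]
      rw [hh, ← Real.rpow_add hU0]
      norm_num
    rw [this]
    exact Real.one_le_rpow hU (by norm_num)
  have hexp : U * Real.exp (-(U / 2)) ≤ 2 := by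
    have a := Real.add_one_le_exp (U / 2)
    rw [Real.exp_neg, ← div_eq_mul_inv, div_le_iff₀ (Real.exp_pos _)]
    linarith
  have hfin : h * (U * |logMeanDiff f ℓ U|) ≤ h * (U * ((20 + 18 * C) * (2 + ℓ) * h)) := by
    refine havg.trans ?_
    have b1 : 1 / (2 * lam) * (∑ k ∈ Finset.Icc 1 K, ArithmeticFunction.vonMangoldt k / k *
          ∫ v in Set.Ioc 0 h, logMeanDiff f ℓ (U + v - Real.log k) ^ 2) ≤
        h * (U * (18 * C * (2 + ℓ) * h)) := by
      calc _ ≤ 1 / (2 * lam) * (18 * (C * (2 * U ^ (0.4 : ℝ)) * (2 + ℓ) ^ 2)) := by gcongr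
        _ = _ := by
          rw [hhU, hlam]
          field_simp
    have b2 : lam * (U + 1) + (2 + ℓ) + U * E ≤ U * (20 * (2 + ℓ) * h) := by
      have c1 : lam * (U + 1) ≤ 2 * (U * ((2 + ℓ) * h)) := by
        have : lam * (U + 1) ≤ lam * (2 * U) := by gcongr; linarith
        rw [hlam] at this ⊢
        linarith
      have c2 : (2 + ℓ) ≤ U * ((2 + ℓ) * h) := by nlinarith
      have c3 : U * E ≤ 4 * (U * h) + 4 * (U * h) := by
        rw [hE]
        nlinarith
      have c4 : U * h ≤ U * ((2 + ℓ) * h) := by nlinarith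
      linarith
    have b3 := mul_le_mul_of_nonneg_left b2 hh0.le
    nlinarith
  have := le_of_mul_le_mul_left (le_of_mul_le_mul_left hfin hh0) hU0
  simpa using this

theorem abs_sum_div_le {f : ℕ → ℝ} (hf : ∀ n, |f n| ≤ 1) {x : ℝ} (hx : 1 ≤ x) :
    |∑ n ∈ Finset.Icc 1 ⌊x⌋₊, f n / n| ≤ 1 + Real.log x := by
  refine le_trans ?_ (harmonic_floor_le_one_add_log x hx)
  rw [harmonic_eq_sum_Icc]
  push_cast
  refine (Finset.abs_sum_le_sum_abs _ _).trans (Finset.sum_le_sum fun n _ => ?_)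
  rw [abs_div, Nat.abs_cast, ← one_div]
  gcongr
  exact hf n

open MeasureTheory in
/-- Partial summation, comparing `∑ f n / n` over `(y, x]` with the mean value of `f` at `x`. -/
theorem abs_sum_div_sub_le {f : ℕ → ℝ} (hf : ∀ n, |f n| ≤ 1) (hf0 : f 0 = 0) {x y B : ℝ} (hy : 0 < y)
    (hyx : y ≤ x) (hB : ∀ t ∈ Set.Icc y x, |logMean f (Real.log x) - logMean f (Real.log t)| ≤ B) :
    |∑ n ∈ Finset.Icc 1 ⌊x⌋₊, f n / n - ∑ n ∈ Finset.Icc 1 ⌊y⌋₊, f n / n -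
      Real.log (x / y) * logMean f (Real.log x)| ≤ B * (1 + Real.log (x / y)) := by
  have hx : 0 < x := hy.trans_le hyx
  have hIcc : ∀ M : ℕ, ∑ k ∈ Finset.Icc 0 M, f k = ∑ k ∈ Finset.Icc 1 M, f k := by
    intro M
    rw [← Finset.add_sum_Ioc_eq_sum_Icc (Nat.zero_le M), hf0, zero_add]
    rfl
  have hpos : ∀ t ∈ Set.Icc y x, t ≠ 0 := fun t ht => (hy.trans_le ht.1).ne'
  have hderiv : ∀ t : ℝ, deriv (fun t : ℝ => t⁻¹) t = -(t ^ 2)⁻¹ := fun t => by simp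
  have hcont : ContinuousOn (fun t : ℝ => -(t ^ 2)⁻¹) (Set.Icc y x) := by
    refine ContinuousOn.neg (ContinuousOn.inv₀ (by fun_prop) fun t ht => pow_ne_zero 2 (hpos t ht))
  have h := sum_mul_eq_sub_sub_integral_mul (f := fun t : ℝ => t⁻¹) f hy.le hyx
    (fun t ht => differentiableAt_inv (hpos t ht))
    (by
      rw [show deriv (fun t : ℝ => t⁻¹) = fun t => -(t ^ 2)⁻¹ from funext hderiv]
      exact hcont.integrableOn_Icc)
  have hsplit : ∑ n ∈ Finset.Icc 1 ⌊x⌋₊, f n / n - ∑ n ∈ Finset.Icc 1 ⌊y⌋₊, f n / n =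
      ∑ k ∈ Finset.Ioc ⌊y⌋₊ ⌊x⌋₊, (k : ℝ)⁻¹ * f k := by
    have e : ∀ M : ℕ, Finset.Icc 1 M = Finset.Ioc 0 M := fun M => by ext; simp; omega
    rw [e, e, ← Finset.sum_Ioc_consecutive _ (Nat.zero_le _) (Nat.floor_le_floor hyx),
      add_sub_cancel_left]
    exact Finset.sum_congr rfl fun k _ => div_eq_inv_mul _ _
  have hint : ∫ t in Set.Ioc y x, deriv (fun t : ℝ => t⁻¹) t * ∑ k ∈ Finset.Icc 0 ⌊t⌋₊, f k =
      - ∫ t in Set.Ioc y x, t⁻¹ * logMean f (Real.log t) := by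
    rw [← integral_neg]
    refine setIntegral_congr_fun measurableSet_Ioc fun t ht => ?_
    have ht0 : 0 < t := hy.trans ht.1
    simp only [hderiv, hIcc, logMean_log f ht0]
    field_simp
  have hinv : IntegrableOn (fun t : ℝ => t⁻¹) (Set.Ioc y x) :=
    ((continuousOn_inv₀.mono fun t ht => hpos t ht).integrableOn_Icc).mono_set
      Set.Ioc_subset_Icc_self
  have hlog : ∫ t in Set.Ioc y x, t⁻¹ = Real.log (x / y) := by
    rw [← intervalIntegral.integral_of_le hyx, integral_inv_of_pos hy hx]
  have hM : IntegrableOn (fun t : ℝ => t⁻¹ * logMean f (Real.log t)) (Set.Ioc y x) := by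
    refine hinv.mul_bdd (c := 1)
      ((measurable_logMean f).comp Real.measurable_log).aestronglyMeasurable ?_
    exact Filter.Eventually.of_forall fun t => abs_logMean_le zero_le_one fun n _ => hf n
  rw [hint, hIcc, hIcc] at h
  rw [hsplit, h]
  have e1 := logMean_log f hx
  have e2 := logMean_log f hy
  rw [one_div] at e1 e2
  rw [← e1, ← e2, ← hlog, ← integral_mul_const, sub_neg_eq_add, add_sub_assoc,
    ← integral_sub hM (hinv.mul_const _)]
  have hlast : |∫ t in Set.Ioc y x, (t⁻¹ * logMean f (Real.log t) -
      t⁻¹ * logMean f (Real.log x))| ≤ ∫ t in Set.Ioc y x, B * t⁻¹ := by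
    rw [← Real.norm_eq_abs]
    refine norm_integral_le_of_norm_le (hinv.const_mul B) ?_
    filter_upwards [ae_restrict_mem measurableSet_Ioc] with t ht
    have ht0 : 0 < t := hy.trans ht.1
    rw [← mul_sub, norm_mul, Real.norm_eq_abs, Real.norm_eq_abs, abs_of_pos (inv_pos.2 ht0),
      mul_comm B, abs_sub_comm]
    gcongr
    exact hB t (Set.Ioc_subset_Icc_self ht)
  rw [integral_const_mul] at hlast
  calc _ ≤ B + B * ∫ t in Set.Ioc y x, t⁻¹ :=
        (abs_add_le _ _).trans (add_le_add (hB y ⟨le_rfl, hyx⟩) hlast)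
    _ = _ := by ring

theorem exists_abs_sum_div_sub_le :
    ∃ C : ℝ, 0 < C ∧ ∀ f : ℕ →*₀ ℝ, (∀ n, |f n| ≤ 1) → ∀ d x : ℝ, 1 ≤ d → Real.exp 1 ≤ x →
      |∑ n ∈ Finset.Icc 1 ⌊x / d⌋₊, f n / n - ∑ n ∈ Finset.Icc 1 ⌊x⌋₊, f n / n +
        Real.log d * logMean f (Real.log x)| ≤
      C * (1 + Real.log d) ^ 2 * Real.log x ^ (-0.2 : ℝ) := by
  obtain ⟨C, hC, hJ⟩ := exists_abs_logMeanDiff_le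
  refine ⟨2 * C + 10, by positivity, fun f hf d x hd hx => ?_⟩
  have hd0 : 0 < d := by linarith
  have hx0 : 0 < x := (Real.exp_pos 1).trans_le hx
  have hx1 : 1 ≤ x := (Real.one_le_exp zero_le_one).trans hx
  have hU : 1 ≤ Real.log x := (Real.le_log_iff_exp_le hx0).2 hx
  have hℓ : 0 ≤ Real.log d := Real.log_nonneg hd
  set U := Real.log x with hUdef
  set ℓ := Real.log d with hℓdef
  have hU5 : 0 < U ^ (-0.2 : ℝ) := Real.rpow_pos_of_pos (by linarith) _
  rcases le_or_gt ℓ (U / 2) with hle | hgt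
  · have hyx : x / d ≤ x := div_le_self hx0.le hd
    have hy : 0 < x / d := by positivity
    have hxy : x / (x / d) = d := by field_simp
    have h := abs_sum_div_sub_le hf (map_zero f) (B := C * (2 + ℓ) * U ^ (-0.2 : ℝ)) hy hyx (by
      intro t ht
      have ht0 : 0 < t := hy.trans_le ht.1
      have h1 : Real.log (x / t) = U - Real.log t := Real.log_div hx0.ne' ht0.ne'
      have h2 : 0 ≤ Real.log (x / t) := Real.log_nonneg ((one_le_div ht0).2 ht.2)
      have h3 : Real.log (x / t) ≤ ℓ := by
        apply Real.log_le_log (by positivity)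
        rw [div_le_iff₀ ht0, mul_comm, ← div_le_iff₀ hd0]
        exact ht.1
      have h4 := hJ f hf (Real.log (x / t)) U hU h2 (h3.trans hle)
      rw [logMeanDiff, h1, sub_sub_cancel] at h4
      refine h4.trans ?_
      gcongr
      exact h1 ▸ h3)
    rw [hxy, ← hℓdef, ← hUdef] at h
    rw [← abs_neg]
    calc _ = _ := by congr 1; ring
      _ ≤ _ := h
      _ = C * ((2 + ℓ) * (1 + ℓ)) * U ^ (-0.2 : ℝ) := by ring
      _ ≤ (C * (2 * (1 + ℓ) ^ 2)) * U ^ (-0.2 : ℝ) := by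
          have : (2 + ℓ) * (1 + ℓ) ≤ 2 * (1 + ℓ) ^ 2 := by nlinarith
          gcongr C * ?_ * _
      _ ≤ _ := by
          gcongr ?_ * _
          nlinarith [sq_nonneg (1 + ℓ)]
  · have h1 : |∑ n ∈ Finset.Icc 1 ⌊x / d⌋₊, f n / n| ≤ 1 + U := by
      rcases lt_or_ge (x / d) 1 with h | h
      · rw [Nat.floor_eq_zero.2 h]
        simp
        linarith
      · refine (abs_sum_div_le hf h).trans ?_
        gcongr
        exact Real.log_le_log (by linarith) (div_le_self hx0.le hd)
    have h2 : |∑ n ∈ Finset.Icc 1 ⌊x⌋₊, f n / n| ≤ 1 + U := abs_sum_div_le hf hx1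
    have h3 : |ℓ * logMean f U| ≤ ℓ := by
      rw [abs_mul, abs_of_nonneg hℓ]
      exact mul_le_of_le_one_right hℓ (abs_logMean_le zero_le_one fun n _ => hf n)
    have h4 : 1 ≤ 2 * (1 + ℓ) * U ^ (-0.2 : ℝ) := by
      have a : U⁻¹ ≤ U ^ (-0.2 : ℝ) := by
        rw [← Real.rpow_neg_one]
        exact Real.rpow_le_rpow_of_exponent_le hU (by norm_num)
      calc 1 = U * U⁻¹ := by field_simp
        _ ≤ _ := by gcongr; linarith
    calc _ ≤ (1 + U) + (1 + U) + ℓ := by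
          refine (abs_add_le _ _).trans (add_le_add ((abs_sub _ _).trans (add_le_add h1 h2)) h3)
      _ ≤ 5 * (1 + ℓ) * 1 := by linarith
      _ ≤ 5 * (1 + ℓ) * (2 * (1 + ℓ) * U ^ (-0.2 : ℝ)) := by gcongr
      _ = 10 * (1 + ℓ) ^ 2 * U ^ (-0.2 : ℝ) := by ring
      _ ≤ _ := by gcongr; linarith

namespace IsMult

theorem isMultiplicative {h : ℕ → ℝ} (hh : IsMult h) (F : ArithmeticFunction ℝ)
    (hF : ∀ n, n ≠ 0 → F n = h n) : F.IsMultiplicative := by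
  rw [ArithmeticFunction.IsMultiplicative.iff_ne_zero]
  refine ⟨by rw [hF 1 one_ne_zero, hh.1], fun {m n} hm hn hmn => ?_⟩
  rw [hF _ hm, hF _ hn, hF _ (mul_ne_zero hm hn), hh.2 m n hmn]

theorem exists_tsum_abs_mul_rpow_le :
    ∃ C : ℝ, ∀ h : ℕ → ℝ, IsMult h → (∀ p : ℕ, p.Prime → h p = 0) →
      (∀ p k : ℕ, p.Prime → |h (p ^ k)| ≤ 2) →
      Summable (fun n : ℕ => |h n| * (n : ℝ) ^ (-(3 / 4) : ℝ)) ∧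
      ∑' n : ℕ, |h n| * (n : ℝ) ^ (-(3 / 4) : ℝ) ≤ C := by
  have hz : Summable fun n : ℕ => (n : ℝ) ^ (-(3 / 2) : ℝ) := by
    rw [Real.summable_nat_rpow]; norm_num
  refine ⟨Real.exp (6 * ∑' n : ℕ, (n : ℝ) ^ (-(3 / 2) : ℝ)), fun h hh h1 h2 => ?_⟩
  set g : ℕ → ℝ := fun n => |h n| * (n : ℝ) ^ (-(3 / 4) : ℝ) with hg
  have hg0 : 0 ≤ g := fun n => by positivity
  have hg1 : g 1 = 1 := by simp [hg, hh.1]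
  have hmul : ∀ {m n : ℕ}, Nat.Coprime m n → g (m * n) = g m * g n := by
    intro m n hmn
    simp only [hg]
    rw [hh.2 m n hmn, abs_mul, Nat.cast_mul, Real.mul_rpow m.cast_nonneg n.cast_nonneg]
    ring
  have hpk : ∀ p k : ℕ, p.Prime → g (p ^ k) ≤ 2 * ((p : ℝ) ^ (-(3 / 4) : ℝ)) ^ k := by
    intro p k hp
    simp only [hg]
    rw [Nat.cast_pow, ← Real.rpow_natCast, ← Real.rpow_natCast, ← Real.rpow_mul p.cast_nonneg,
      ← Real.rpow_mul p.cast_nonneg, mul_comm (k : ℝ)]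
    gcongr
    exact h2 p k hp
  have hr : ∀ p : ℕ, p.Prime → (p : ℝ) ^ (-(3 / 4) : ℝ) ≤ 0.6 := by
    intro p hp
    have hp2 : (2 : ℝ) ≤ p := by exact_mod_cast hp.two_le
    calc (p : ℝ) ^ (-(3 / 4) : ℝ) ≤ 2 ^ (-(3 / 4) : ℝ) :=
          Real.rpow_le_rpow_of_nonpos (by norm_num) hp2 (by norm_num)
      _ = ((1 / 8 : ℝ)) ^ (1 / 4 : ℝ) := by
          rw [show (1 / 8 : ℝ) = 2 ^ (-3 : ℝ) by norm_num, ← Real.rpow_mul (by norm_num)]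
          norm_num
      _ ≤ ((0.6 : ℝ) ^ 4) ^ (1 / 4 : ℝ) := by
          gcongr
          norm_num
      _ = 0.6 := by
          rw [← Real.rpow_natCast, ← Real.rpow_mul (by norm_num)]
          norm_num
  have hsum : ∀ {p : ℕ}, p.Prime → Summable fun k : ℕ => g (p ^ k) := by
    intro p hp
    refine Summable.of_nonneg_of_le (fun k => hg0 _) (fun k => hpk p k hp) ?_
    exact (summable_geometric_of_lt_one (by positivity) (by linarith [hr p hp])).mul_left 2
  have hfac : ∀ p : ℕ, p.Prime → ∑' k : ℕ, g (p ^ k) ≤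
      Real.exp (6 * (p : ℝ) ^ (-(3 / 2) : ℝ)) := by
    intro p hp
    set r := (p : ℝ) ^ (-(3 / 4) : ℝ) with hrdef
    have hr0 : 0 ≤ r := by positivity
    have hr1 := hr p hp
    have hr2 : (p : ℝ) ^ (-(3 / 2) : ℝ) = r ^ 2 := by
      rw [hrdef, ← Real.rpow_natCast, ← Real.rpow_mul p.cast_nonneg]
      norm_num
    rw [← (hsum hp).sum_add_tsum_nat_add 2, hr2]
    have e : ∑ i ∈ Finset.range 2, g (p ^ i) = 1 := by
      simp [Finset.sum_range_succ, hg1]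
      simp [hg, h1 p hp]
    have hgeo := (hasSum_geometric_of_lt_one hr0 (by linarith : r < 1)).mul_left (2 * r ^ 2)
    have htail : ∑' k : ℕ, g (p ^ (k + 2)) ≤ 2 * r ^ 2 * (1 - r)⁻¹ := by
      rw [← hgeo.tsum_eq]
      refine Summable.tsum_le_tsum (fun k => ?_) ((summable_nat_add_iff 2).2 (hsum hp)) hgeo.summable
      refine (hpk p (k + 2) hp).trans (le_of_eq ?_)
      rw [← hrdef]
      ring
    have : (1 - r)⁻¹ ≤ 3 := by
      rw [inv_le_comm₀ (by linarith) (by norm_num)]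
      linarith
    have : 2 * r ^ 2 * (1 - r)⁻¹ ≤ 2 * r ^ 2 * 3 := by gcongr
    linarith [Real.add_one_le_exp (6 * r ^ 2)]
  have hfin : ∀ s : Finset ℕ, ∑ n ∈ s, g n ≤ Real.exp (6 * ∑' n : ℕ, (n : ℝ) ^ (-(3 / 2) : ℝ)) := by
    intro s
    obtain ⟨N, hN⟩ : ∃ N : ℕ, ∀ n ∈ s, n < N := by
      refine ⟨s.sup id + 1, fun n hn => Nat.lt_succ_of_le (Finset.le_sup (f := id) hn)⟩
    obtain ⟨hs1, hs2⟩ := EulerProduct.summable_and_hasSum_smoothNumbers_prod_primesBelow_tsum hg1 hmul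
      (fun hp => by simpa only [Real.norm_eq_abs] using (hsum hp).abs) N
    have hprod : ∏ p ∈ N.primesBelow, ∑' n : ℕ, g (p ^ n) ≤
        Real.exp (6 * ∑' n : ℕ, (n : ℝ) ^ (-(3 / 2) : ℝ)) := by
      calc _ ≤ ∏ p ∈ N.primesBelow, Real.exp (6 * (p : ℝ) ^ (-(3 / 2) : ℝ)) :=
            Finset.prod_le_prod (fun p _ => tsum_nonneg fun k => hg0 _)
              fun p hp => hfac p (Nat.prime_of_mem_primesBelow hp)
        _ = Real.exp (6 * ∑ p ∈ N.primesBelow, (p : ℝ) ^ (-(3 / 2) : ℝ)) := by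
            rw [← Real.exp_sum, Finset.mul_sum]
        _ ≤ _ := by
            gcongr
            exact hz.sum_le_tsum _ fun n _ => by positivity
    refine le_trans ?_ hprod
    replace hs2 := (hasSum_subtype_iff_indicator (f := g)).1 hs2
    refine le_trans (Finset.sum_le_sum (g := N.smoothNumbers.indicator g) fun n hn => ?_)
      (sum_le_hasSum s (fun n _ => Set.indicator_nonneg (fun m _ => hg0 m) n) hs2)
    · rcases Nat.eq_zero_or_pos n with rfl | hpos
      · have : g 0 = 0 := by
          simp only [hg]
          rw [Nat.cast_zero, Real.zero_rpow (by norm_num), mul_zero]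
        rw [this]
        exact Set.indicator_nonneg (fun m _ => hg0 m) 0
      · rw [Set.indicator_of_mem (Nat.mem_smoothNumbers_of_lt hpos (hN n hn))]
  exact ⟨summable_of_sum_le hg0 hfin, Real.tsum_le_of_sum_le hg0 hfin⟩

/-- The sum `∑ h(n)/n` is nonnegative when `h` is the Dirichlet quotient of a multiplicative function
bounded by `1` by the completely multiplicative function with the same values at primes. -/
theorem tsum_div_nonneg {fs h : ℕ → ℝ} (hfs : IsMult fs) (hfs1 : ∀ n, 0 < n → |fs n| ≤ 1)
    (hh : IsMult h) (hpk : ∀ p : ℕ, p.Prime → ∀ k : ℕ,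
      h (p ^ (k + 1)) = fs (p ^ (k + 1)) - fs p * fs (p ^ k))
    (hsum : Summable fun n : ℕ => |h n / n|) : 0 ≤ ∑' n : ℕ, h n / n := by
  have hP := EulerProduct.eulerProduct_hasProd (f := fun n : ℕ => h n / n) (by simp [hh.1])
    (fun {m n} hmn => by simp only [hh.2 m n hmn, Nat.cast_mul, mul_div_mul_comm])
    (by simpa only [Real.norm_eq_abs] using hsum) (by simp)
  refine ge_of_tendsto' hP fun s => Finset.prod_nonneg fun p _ => ?_
  obtain ⟨p, hp⟩ := p
  have hp2 : (2 : ℝ) ≤ p := by exact_mod_cast hp.two_le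
  set b : ℕ → ℝ := fun e => fs (p ^ e) / ((p : ℝ) ^ e) with hb
  have hb1 : ∀ e, |b e| ≤ (1 / 2 : ℝ) ^ e := by
    intro e
    have h1 := hfs1 (p ^ e) (pow_pos hp.pos e)
    rw [hb, abs_div, abs_of_nonneg (show (0 : ℝ) ≤ (p : ℝ) ^ e by positivity), one_div, inv_pow,
      ← one_div]
    gcongr
  have hbs : Summable b :=
    Summable.of_norm_bounded (summable_geometric_of_lt_one (by norm_num) (by norm_num)) hb1
  have hb0 : b 0 = 1 := by simp [hb, hfs.1]
  have hbn : 0 ≤ ∑' e, b e := by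
    rw [hbs.tsum_eq_zero_add, hb0]
    have hgeo : HasSum (fun e : ℕ => (1 / 2 : ℝ) ^ (e + 1)) 1 := by
      have := (hasSum_geometric_of_lt_one (r := (1 / 2 : ℝ)) (by norm_num) (by norm_num)).mul_right
        (1 / 2 : ℝ)
      norm_num at this
      simpa [pow_succ] using this
    have := tsum_of_norm_bounded (f := fun e => b (e + 1)) hgeo fun e => hb1 (e + 1)
    linarith [(abs_le.1 this).1]
  have hr : fs p / p ≤ 1 := by
    have := hb1 1
    simp [hb] at this
    linarith [le_abs_self (fs p / p)]
  have key : HasSum (fun e : ℕ => h (p ^ e) / ((p ^ e : ℕ) : ℝ)) ((1 - fs p / p) * ∑' e, b e) := by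
    rw [← hasSum_nat_add_iff' 1]
    have e1 := ((hasSum_nat_add_iff' 1).2 hbs.hasSum).sub (hbs.hasSum.mul_left (fs p / p))
    convert! e1 using 1
    · funext e
      rw [hpk p hp e]
      simp only [hb]
      push_cast
      have : (p : ℝ) ≠ 0 := by positivity
      field_simp
      ring
    · simp [hb0, hh.1]
      ring
  change 0 ≤ ∑' e : ℕ, h (p ^ e) / ((p ^ e : ℕ) : ℝ)
  rw [key.tsum_eq]
  exact mul_nonneg (by linarith) hbn

end IsMult

namespace IsComplMult

/-- The completely multiplicative function as a monoid-with-zero homomorphism, with the value at `0`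
replaced by `0`. -/
noncomputable def toMonoidWithZeroHom {f : ℕ → ℝ} (hf : IsComplMult f) : ℕ →*₀ ℝ where
  toFun n := if n = 0 then 0 else f n
  map_zero' := if_pos rfl
  map_one' := by rw [if_neg one_ne_zero, hf.1]
  map_mul' m n := by
    rcases Nat.eq_zero_or_pos m with rfl | hm
    · simp
    rcases Nat.eq_zero_or_pos n with rfl | hn
    · simp
    rw [if_neg hm.ne', if_neg hn.ne', if_neg (mul_pos hm hn).ne', hf.2 m n hm hn]

theorem toMonoidWithZeroHom_apply {f : ℕ → ℝ} (hf : IsComplMult f) {n : ℕ} (hn : n ≠ 0) :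
    hf.toMonoidWithZeroHom n = f n := if_neg hn

end IsComplMult

theorem MonoidWithZeroHom.abs_le_one_of_prime {f : ℕ →*₀ ℝ} (h : ∀ p : ℕ, p.Prime → |f p| ≤ 1)
    (n : ℕ) : |f n| ≤ 1 := by
  induction n using induction_on_primes with
  | zero => simp
  | one => simp
  | prime_mul p a hp ha =>
    rw [map_mul, abs_mul]
    exact mul_le_one₀ (h p hp) (abs_nonneg _) ha

/-- A monoid-with-zero homomorphism, as an arithmetic function. -/
def MonoidWithZeroHom.toArithmeticFunction (F : ℕ →*₀ ℝ) : ArithmeticFunction ℝ :=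
  ⟨F, _root_.map_zero F⟩

theorem ArithmeticFunction.mul_eq_of_prime_pow {F : ℕ →*₀ ℝ} {fs h : ArithmeticFunction ℝ}
    (hfs : fs.IsMultiplicative) (hh : h.IsMultiplicative)
    (hpk : ∀ p k : ℕ, p.Prime → h (p ^ (k + 1)) = fs (p ^ (k + 1)) - F p * fs (p ^ k)) :
    h * F.toArithmeticFunction = fs := by
  have hF : F.toArithmeticFunction.IsMultiplicative :=
    ⟨_root_.map_one F, fun {m n} _ => _root_.map_mul F m n⟩
  rw [ArithmeticFunction.IsMultiplicative.eq_iff_eq_on_prime_powers _ (hh.mul hF) _ hfs]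
  intro p i hp
  have hp0 : 0 < p := hp.pos
  have expand : ∀ i : ℕ, (h * F.toArithmeticFunction) (p ^ i) =
      ∑ j ∈ Finset.range (i + 1), h (p ^ j) * F p ^ (i - j) := by
    intro i
    rw [ArithmeticFunction.mul_apply]
    change ∑ x ∈ (p ^ i).divisorsAntidiagonal, h x.1 * F x.2 = _
    rw [Nat.sum_divisorsAntidiagonal (f := fun a b => h a * F b), Nat.divisors_prime_pow hp,
      Finset.sum_map]
    refine Finset.sum_congr rfl fun j hj => ?_
    rw [Finset.mem_range] at hj
    simp only [Function.Embedding.coeFn_mk]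
    rw [Nat.pow_div (by omega) hp0, _root_.map_pow F]
  rw [expand]
  induction i with
  | zero => simp [hh.1, hfs.1]
  | succ i ih =>
    rw [Finset.sum_range_succ, Nat.sub_self, pow_zero, mul_one, hpk p i hp, ← ih, Finset.mul_sum]
    have : ∑ j ∈ Finset.range (i + 1), h (p ^ j) * F p ^ (i + 1 - j) =
        ∑ j ∈ Finset.range (i + 1), F p * (h (p ^ j) * F p ^ (i - j)) := by
      refine Finset.sum_congr rfl fun j hj => ?_
      rw [Finset.mem_range] at hj
      rw [show i + 1 - j = (i - j) + 1 by omega, pow_succ]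
      ring
    rw [this]
    ring

theorem ArithmeticFunction.sum_mul_div_eq (a b : ArithmeticFunction ℝ) (x : ℝ) :
    ∑ n ∈ Finset.Icc 1 ⌊x⌋₊, (a * b) n / n =
      ∑ d ∈ Finset.Icc 1 ⌊x⌋₊, a d / d * ∑ m ∈ Finset.Icc 1 ⌊x / d⌋₊, b m / m := by
  let D : ArithmeticFunction ℝ → ArithmeticFunction ℝ := fun a => ⟨fun n => a n / n, by simp⟩
  have h := ArithmeticFunction.sum_Ioc_mul_eq_sum_sum (D a) (D b) ⌊x⌋₊
  have hD : ∀ n : ℕ, (D a * D b) n = (a * b) n / n := by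
    intro n
    rw [ArithmeticFunction.mul_apply, ArithmeticFunction.mul_apply, Finset.sum_div]
    refine Finset.sum_congr rfl fun p hp => ?_
    change a p.1 / p.1 * (b p.2 / p.2) = _
    rw [← (Nat.mem_divisorsAntidiagonal.1 hp).1, Nat.cast_mul, div_mul_div_comm]
  simp_rw [hD] at h
  simp_rw [Nat.floor_div_natCast]
  exact h

theorem sq_one_add_log_div_le {n : ℕ} (hn : n ≠ 0) :
    (1 + Real.log n) ^ 2 / n ≤ 81 * (n : ℝ) ^ (-(3 / 4) : ℝ) := by
  have hn0 : (0 : ℝ) < n := by exact_mod_cast Nat.pos_of_ne_zero hn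
  have hn1 : (1 : ℝ) ≤ n := by exact_mod_cast Nat.pos_of_ne_zero hn
  have h1 := Real.log_le_rpow_div hn0.le (show (0 : ℝ) < 1 / 8 by norm_num)
  have h2 : 1 ≤ (n : ℝ) ^ (1 / 8 : ℝ) := Real.one_le_rpow hn1 (by norm_num)
  have h3 : 0 ≤ Real.log n := Real.log_nonneg hn1
  calc (1 + Real.log n) ^ 2 / n ≤ (9 * (n : ℝ) ^ (1 / 8 : ℝ)) ^ 2 / n := by
        gcongr
        linarith
    _ = 81 * ((n : ℝ) ^ (1 / 4 : ℝ) * (n : ℝ) ^ (-1 : ℝ)) := by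
        rw [mul_pow, ← Real.rpow_natCast ((n : ℝ) ^ (1 / 8 : ℝ)), ← Real.rpow_mul hn0.le,
          Real.rpow_neg_one]
        norm_num
        ring
    _ = _ := by
        rw [← Real.rpow_add hn0]
        norm_num

theorem exists_decomposition_sum_bound :
    ∃ C : ℝ, ∀ fs f h : ℕ → ℝ,
      IsMult fs → (∀ n : ℕ, 0 < n → -1 ≤ fs n ∧ fs n ≤ 1) →
      IsComplMult f → (∀ p : ℕ, p.Prime → f p = fs p) →
      IsMult h →
      (∀ p : ℕ, p.Prime → ∀ k : ℕ, 1 ≤ k →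
        h (p ^ k) = fs (p ^ k) - fs p * fs (p ^ (k - 1))) →
      Summable (fun d : ℕ => |h d| / d)
      ∧ Summable (fun d : ℕ => |h d * Real.log d| / d)
      ∧ 0 ≤ (∑' d : ℕ, h d / d)
      ∧ ∀ x : ℝ, Real.exp 1 ≤ x →
          |(∑ n ∈ Finset.Icc 1 ⌊x⌋₊, fs n / n)
              - (∑' d : ℕ, h d / d) * ∑ n ∈ Finset.Icc 1 ⌊x⌋₊, f n / n
              - (-(∑' d : ℕ, h d * Real.log d / d)) *
                  ((1 / x) * ∑ n ∈ Finset.Icc 1 ⌊x⌋₊, f n)|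
            ≤ C / (Real.log x) ^ ((1 : ℝ) / 5) := by
  obtain ⟨A, hA⟩ := IsMult.exists_tsum_abs_mul_rpow_le
  obtain ⟨C, hC, hL⟩ := exists_abs_sum_div_sub_le
  refine ⟨C * (81 * A), fun fs f h hfs hfs1 hf hfp hh hhp => ?_⟩
  have hfsabs : ∀ n, 0 < n → |fs n| ≤ 1 := fun n hn => abs_le.2 (hfs1 n hn)
  have hpk : ∀ p : ℕ, p.Prime → ∀ k : ℕ, h (p ^ (k + 1)) = fs (p ^ (k + 1)) - fs p * fs (p ^ k) :=
    fun p hp k => by simpa using hhp p hp (k + 1) (by omega)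
  have hprime : ∀ p : ℕ, p.Prime → h p = 0 := fun p hp => by
    simpa [hfs.1] using hpk p hp 0
  have hle2 : ∀ p k : ℕ, p.Prime → |h (p ^ k)| ≤ 2 := by
    intro p k hp
    rcases k with _ | k
    · simp [hh.1]
    · rw [hpk p hp k]
      refine (abs_sub _ _).trans ?_
      rw [abs_mul]
      have h1 := hfsabs (p ^ (k + 1)) (pow_pos hp.pos _)
      have h2 := hfsabs (p ^ k) (pow_pos hp.pos _)
      have h3 := hfsabs p hp.pos
      have := mul_le_one₀ h3 (abs_nonneg _) h2
      linarith
  obtain ⟨hs, hsA⟩ := hA h hh hprime hle2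
  have hw : ∀ n : ℕ, |h n| * ((1 + Real.log n) ^ 2 / n) ≤ 81 * (|h n| * (n : ℝ) ^ (-(3 / 4) : ℝ)) := by
    intro n
    rcases eq_or_ne n 0 with rfl | hn
    · simp
    · calc _ ≤ |h n| * (81 * (n : ℝ) ^ (-(3 / 4) : ℝ)) := by gcongr; exact sq_one_add_log_div_le hn
        _ = _ := by ring
  have hlogn : ∀ n : ℕ, 0 ≤ Real.log n := fun n => Real.log_natCast_nonneg n
  have hws : Summable fun n : ℕ => |h n| * ((1 + Real.log n) ^ 2 / n) :=
    Summable.of_nonneg_of_le (fun n => by positivity) hw (hs.mul_left 81)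
  have hwA : ∑' n : ℕ, |h n| * ((1 + Real.log n) ^ 2 / n) ≤ 81 * A := by
    refine (hws.tsum_le_tsum hw (hs.mul_left 81)).trans ?_
    rw [tsum_mul_left]
    gcongr
  have hs0 : Summable fun n : ℕ => |h n| / n := by
    refine Summable.of_nonneg_of_le (fun n => by positivity) (fun n => ?_) hws
    rw [div_eq_mul_one_div]
    gcongr
    nlinarith [hlogn n]
  have hs1 : Summable fun n : ℕ => |h n * Real.log n| / n := by
    refine Summable.of_nonneg_of_le (fun n => by positivity) (fun n => ?_) hws
    rw [abs_mul, mul_div_assoc, abs_of_nonneg (hlogn n)]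
    gcongr
    nlinarith [hlogn n]
  have hs0' : Summable fun n : ℕ => h n / n :=
    Summable.of_norm (by simpa [abs_div] using hs0)
  have hs1' : Summable fun n : ℕ => h n * Real.log n / n :=
    Summable.of_norm (by simpa [abs_div] using hs1)
  refine ⟨hs0, hs1, IsMult.tsum_div_nonneg hfs hfsabs hh hpk (by simpa [abs_div] using hs0),
    fun x hx => ?_⟩
  have hx0 : 0 < x := (Real.exp_pos 1).trans_le hx
  have hU : 1 ≤ Real.log x := (Real.le_log_iff_exp_le hx0).2 hx
  set F := hf.toMonoidWithZeroHom with hFdef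
  have hF : ∀ n, n ≠ 0 → F n = f n := fun n hn => hf.toMonoidWithZeroHom_apply hn
  have hF1 : ∀ n, |F n| ≤ 1 := MonoidWithZeroHom.abs_le_one_of_prime fun p hp => by
    rw [hF p hp.ne_zero, hfp p hp]
    exact hfsabs p hp.pos
  have hext : ∀ a : ℕ → ℝ, ∀ n, n ≠ 0 → toArithmeticFunction a n = a n := fun a n hn => if_neg hn
  have hconv : toArithmeticFunction h * F.toArithmeticFunction = toArithmeticFunction fs := by
    refine ArithmeticFunction.mul_eq_of_prime_pow (hfs.isMultiplicative _ (hext fs))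
      (hh.isMultiplicative _ (hext h)) fun p k hp => ?_
    rw [hext _ _ (pow_ne_zero _ hp.ne_zero), hext _ _ (pow_ne_zero _ hp.ne_zero),
      hext _ _ (pow_ne_zero _ hp.ne_zero), hF p hp.ne_zero, hfp p hp, hpk p hp k]
  have hne : ∀ {N n : ℕ}, n ∈ Finset.Icc 1 N → n ≠ 0 := fun hn => by
    rw [Finset.mem_Icc] at hn
    omega
  set L : ℝ → ℝ := fun y => ∑ n ∈ Finset.Icc 1 ⌊y⌋₊, F n / n with hLdef
  set M := logMean F (Real.log x) with hMdef
  have e1 : ∑ n ∈ Finset.Icc 1 ⌊x⌋₊, fs n / n = ∑' d : ℕ, h d / d * L (x / d) := by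
    rw [tsum_eq_sum (s := Finset.Icc 1 ⌊x⌋₊)]
    · have := ArithmeticFunction.sum_mul_div_eq (toArithmeticFunction h) F.toArithmeticFunction x
      rw [hconv] at this
      rw [Finset.sum_congr rfl fun n hn => by rw [← hext fs n (hne hn)], this]
      refine Finset.sum_congr rfl fun d hd => ?_
      rw [hext h d (hne hd)]
      rfl
    · intro d hd
      rcases Nat.eq_zero_or_pos d with rfl | hd0
      · simp
      · have hd0' : (0 : ℝ) < d := by exact_mod_cast hd0
        have : x < d := by
          refine (Nat.floor_lt hx0.le).1 ?_
          by_contra hcon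
          exact hd (Finset.mem_Icc.2 ⟨hd0, not_lt.1 hcon⟩)
        simp only [hLdef]
        rw [Nat.floor_eq_zero.2 ((div_lt_one hd0').2 this)]
        simp
  have e2 : ∑ n ∈ Finset.Icc 1 ⌊x⌋₊, f n / n = L x :=
    Finset.sum_congr rfl fun n hn => by rw [hF n (hne hn)]
  have e3 : (1 / x) * ∑ n ∈ Finset.Icc 1 ⌊x⌋₊, f n = M := by
    rw [hMdef, logMean_log _ hx0]
    congr 1
    exact Finset.sum_congr rfl fun n hn => by rw [hF n (hne hn)]
  have hbound : ∀ d : ℕ, ‖h d / d * (L (x / d) - L x + Real.log d * M)‖ ≤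
      C * Real.log x ^ (-0.2 : ℝ) * (|h d| * ((1 + Real.log d) ^ 2 / d)) := by
    intro d
    rcases Nat.eq_zero_or_pos d with rfl | hd0
    · simp
    · rw [Real.norm_eq_abs, abs_mul, abs_div, Nat.abs_cast]
      have := hL F hF1 d x (by exact_mod_cast hd0) hx
      calc _ ≤ |h d| / d * (C * (1 + Real.log d) ^ 2 * Real.log x ^ (-0.2 : ℝ)) := by gcongr
        _ = _ := by ring
  have hsum : Summable fun d : ℕ => h d / d * (L (x / d) - L x + Real.log d * M) :=
    Summable.of_norm_bounded (hws.mul_left _) hbound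
  have e4 : (∑' d : ℕ, h d / d * L (x / d)) - (∑' d : ℕ, h d / d) * L x -
      (-(∑' d : ℕ, h d * Real.log d / d)) * M =
      ∑' d : ℕ, h d / d * (L (x / d) - L x + Real.log d * M) := by
    have hrest : HasSum (fun d : ℕ => h d / d * L x - h d * Real.log d / d * M)
        ((∑' d : ℕ, h d / d) * L x - (∑' d : ℕ, h d * Real.log d / d) * M) :=
      (hs0'.hasSum.mul_right _).sub (hs1'.hasSum.mul_right _)
    have h2 := (hsum.hasSum.add hrest).tsum_eq
    have h3 : (fun d : ℕ => h d / d * (L (x / d) - L x + Real.log d * M) +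
        (h d / d * L x - h d * Real.log d / d * M)) = fun d : ℕ => h d / d * L (x / d) := by
      funext d
      ring
    rw [h3] at h2
    rw [h2]
    ring
  rw [e1, e2, e3, e4, ← Real.norm_eq_abs]
  refine (tsum_of_norm_bounded (hws.mul_left _).hasSum hbound).trans ?_
  rw [tsum_mul_left]
  calc _ ≤ C * Real.log x ^ (-0.2 : ℝ) * (81 * A) := by gcongr
    _ = _ := by
      rw [show (-0.2 : ℝ) = -(1 / 5) by norm_num, Real.rpow_neg (by linarith)]
      ring

/-- with `f` the completely multiplicative function agreeing with the
multiplicative `f*` on primes and `h` the multiplicative function with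
`h(p^k) = f*(p^k) - f*(p) f*(p^{k-1})`, the series `H₀ = ∑ h(d)/d` and
`H₁ = -∑ h(d) log d / d` converge absolutely, `H₀ ≥ 0`, and (with absolute constants
`C`, `x₀`) for `x ≥ x₀`:
`∑_{n ≤ x} f*(n)/n = H₀ ∑_{n ≤ x} f(n)/n + H₁ (1/x) ∑_{n ≤ x} f(n) + O(1/(log x)^{1/5})`. -/
theorem dirichlet_decomposition_sum_formula :
    ∃ C x₀ : ℝ,
      ∀ fs f h : ℕ → ℝ,
        IsMult fs → (∀ n : ℕ, 0 < n → -1 ≤ fs n ∧ fs n ≤ 1) →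
        IsComplMult f → (∀ p : ℕ, p.Prime → f p = fs p) →
        IsMult h →
        (∀ p : ℕ, p.Prime → ∀ k : ℕ, 1 ≤ k →
          h (p ^ k) = fs (p ^ k) - fs p * fs (p ^ (k - 1))) →
        Summable (fun d : ℕ => |h (d + 1)| / (d + 1))
        ∧ Summable (fun d : ℕ => |h (d + 1) * Real.log (d + 1)| / (d + 1))
        ∧ 0 ≤ (∑' d : ℕ, h (d + 1) / (d + 1))
        ∧ ∀ x : ℝ, x₀ ≤ x →
            |(∑ n ∈ Finset.Icc 1 ⌊x⌋₊, fs n / n)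
                - (∑' d : ℕ, h (d + 1) / (d + 1)) * ∑ n ∈ Finset.Icc 1 ⌊x⌋₊, f n / n
                - (-(∑' d : ℕ, h (d + 1) * Real.log (d + 1) / (d + 1))) *
                    ((1 / x) * ∑ n ∈ Finset.Icc 1 ⌊x⌋₊, f n)|
              ≤ C / (Real.log x) ^ ((1 : ℝ) / 5) := by
  obtain ⟨C, hC⟩ := exists_decomposition_sum_bound
  refine ⟨C, Real.exp 1, fun fs f h hfs hfs1 hf hfp hh hhp => ?_⟩
  obtain ⟨hs0, hs1, hnonneg, hbound⟩ := hC fs f h hfs hfs1 hf hfp hh hhp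
  have hs0' : Summable fun d : ℕ => h d / d := Summable.of_norm (by simpa [abs_div] using hs0)
  have hs1' : Summable fun d : ℕ => h d * Real.log d / d :=
    Summable.of_norm (by simpa [abs_div] using hs1)
  have e0 : ∑' d : ℕ, h (d + 1) / ((d : ℝ) + 1) = ∑' d : ℕ, h d / d := by
    rw [hs0'.tsum_eq_zero_add]
    simp
  have e1 : ∑' d : ℕ, h (d + 1) * Real.log ((d : ℝ) + 1) / ((d : ℝ) + 1) =
      ∑' d : ℕ, h d * Real.log d / d := by
    rw [hs1'.tsum_eq_zero_add]
    simp
  rw [e0, e1]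
  exact ⟨by simpa using (summable_nat_add_iff 1).2 hs0,
    by simpa using (summable_nat_add_iff 1).2 hs1, hnonneg, hbound⟩
end

section
/- For every real x ≥ 1 and every completely multiplicative function f with f(n) ∈ {-1, 0, 1} for all positive integers n, there exists a primitive quadratic Dirichlet character χ (modulo some positive integer q) such that χ(n) = f(n) for all positive integers n ≤ x. Consequently, the minimum of ∑_{n ≤ x} χ(n)/n over primitive quadratic Dirichlet characters χ equals δ₀(x) = min over completely multiplicative f with values in {-1,0,1} of ∑_{n ≤ x} f(n)/n. -/
/-- A completely multiplicative map `ℤ → {-1, 0, 1}` with period `q` that vanishes exactly at the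
integers not coprime to `q` is a quadratic Dirichlet character; it is primitive as soon as, for
every prime `p ∣ q`, it takes the value `-1` on the residue class of `1` modulo `q / p`. -/
theorem exists_primitive_quadratic_of_periodic {q : ℕ} (hq : 1 < q) (φ : ℤ →* ℤ)
    (hper : ∀ a b, a ≡ b [ZMOD q] → φ a = φ b)
    (hval : ∀ a, φ a = 0 ∨ φ a = 1 ∨ φ a = -1)
    (hzero : ∀ a, ¬ IsCoprime a (q : ℤ) → φ a = 0)
    (hprim : ∀ p : ℕ, p.Prime → p ∣ q → ∃ a : ℤ, a ≡ 1 [ZMOD (q / p : ℕ)] ∧ φ a = -1) :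
    ∃ χ : DirichletCharacter ℝ q, χ.IsPrimitive ∧ MulChar.IsQuadratic χ ∧ χ ≠ 1 ∧
      ∀ a : ℤ, χ (a : ZMod q) = φ a := by
  have : NeZero q := ⟨by omega⟩
  have hval' (a : ℤ) : φ ((a : ZMod q).val : ℤ) = φ a := by
    apply hper
    rw [← ZMod.intCast_eq_intCast_iff]
    simp
  let χ : DirichletCharacter ℝ q :=
    { toFun := fun a => (φ (a.val : ℤ) : ℝ)
      map_one' := by
        have := hval' 1
        rw [Int.cast_one, map_one] at this
        rw [this, Int.cast_one]
      map_mul' := fun a b => by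
        have h : φ ((a * b).val : ℤ) = φ ((a.val : ℤ) * (b.val : ℤ)) := by
          rw [← hval' ((a.val : ℤ) * (b.val : ℤ))]
          simp
        simp only [h, map_mul]
        push_cast
        rfl
      map_nonunit' := fun a ha => by
        have : φ (a.val : ℤ) = 0 := by
          apply hzero
          rw [Nat.isCoprime_iff_coprime]
          intro h
          apply ha
          have := (ZMod.isUnit_iff_coprime a.val q).2 h
          simpa using this
        rw [this, Int.cast_zero] }
  have hχ (a : ℤ) : χ (a : ZMod q) = φ a := by
    change ((φ (((a : ZMod q)).val : ℤ) : ℤ) : ℝ) = φ a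
    rw [hval']
  have hcop {a : ℤ} (ha : φ a = -1) : IsCoprime a (q : ℤ) := by
    by_contra h
    rw [hzero a h] at ha
    omega
  refine ⟨χ, ?_, ?_, ?_, hχ⟩
  · by_contra hne
    have hd := χ.conductor_dvd_level
    obtain ⟨k, hk⟩ := hd
    have hk1 : k ≠ 1 := by
      rintro rfl
      exact hne (by rw [DirichletCharacter.isPrimitive_def]; omega)
    obtain ⟨p, hp, hpk⟩ := Nat.exists_prime_and_dvd hk1
    obtain ⟨j, rfl⟩ := hpk
    have hqp : q / p = χ.conductor * j := by
      conv_lhs => rw [hk]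
      rw [show χ.conductor * (p * j) = (χ.conductor * j) * p by ring]
      exact Nat.mul_div_cancel _ hp.pos
    obtain ⟨a, ha, hφ⟩ := hprim p hp (hk ▸ ⟨χ.conductor * j, by ring⟩)
    have hone : (a : ZMod χ.conductor) = 1 := by
      have : a ≡ 1 [ZMOD χ.conductor] :=
        ha.of_dvd (by rw [hqp]; exact_mod_cast dvd_mul_right _ _)
      simpa using (ZMod.intCast_eq_intCast_iff _ _ _).2 this
    have h1 := χ.primitiveCharacter_apply_of_isCoprime (hcop hφ)
    rw [hχ, hone, map_one, hφ] at h1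
    norm_num at h1
  · intro a
    rcases hval (a.val : ℤ) with h | h | h
    · left
      change ((φ (a.val : ℤ) : ℤ) : ℝ) = 0
      rw [h]; norm_num
    · right; left
      change ((φ (a.val : ℤ) : ℤ) : ℝ) = 1
      rw [h]; norm_num
    · right; right
      change ((φ (a.val : ℤ) : ℤ) : ℝ) = -1
      rw [h]; norm_num
  · intro h1
    obtain ⟨p, hp, hpq⟩ := Nat.exists_prime_and_dvd hq.ne'
    obtain ⟨a, -, hφ⟩ := hprim p hp hpq
    have hu : IsUnit (a : ZMod q) := (ZMod.coe_int_isUnit_iff_isCoprime a q).2 (hcop hφ).symm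
    have h2 := hχ a
    rw [h1, MulChar.one_apply hu, hφ] at h2
    norm_num at h2

/-- Completely multiplicative functions agreeing on the primes up to `N` agree up to `N`. -/
theorem eq_of_eq_on_primes {f g : ℕ → ℝ} (hf1 : f 1 = 1) (hg1 : g 1 = 1)
    (hf : ∀ m n, 0 < m → 0 < n → f (m * n) = f m * f n)
    (hg : ∀ m n, 0 < m → 0 < n → g (m * n) = g m * g n) {N : ℕ}
    (h : ∀ p, p.Prime → p ≤ N → f p = g p) {n : ℕ} (hn : 0 < n) (hnN : n ≤ N) : f n = g n := by
  induction n using Nat.recOnMul with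
  | zero => omega
  | one => rw [hf1, hg1]
  | prime p hp => exact h p hp hnN
  | mul a b iha ihb =>
    have ha : 0 < a := Nat.pos_of_mul_pos_right hn
    have hb : 0 < b := Nat.pos_of_mul_pos_left hn
    rw [hf a b ha hb, hg a b ha hb, iha ha ((Nat.le_mul_of_pos_right a hb).trans hnN),
      ihb hb ((Nat.le_mul_of_pos_left b ha).trans hnN)]

/-- An integer that is `1` modulo `4 * (m / p)` and a quadratic nonresidue modulo `p`. -/
theorem exists_jacobiSym_eq_neg_one {m : ℕ} (hodd : Odd m) (hsq : Squarefree m) {p : ℕ}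
    (hp : p.Prime) (hpm : p ∣ m) :
    ∃ a : ℤ, a ≡ 1 [ZMOD (4 * (m / p) : ℕ)] ∧ jacobiSym a m = -1 := by
  have : Fact p.Prime := ⟨hp⟩
  obtain ⟨k, rfl⟩ := hpm
  rw [Nat.mul_div_cancel_left k hp.pos]
  have hk : 0 < k := Nat.pos_of_ne_zero (by rintro rfl; simp at hodd)
  have hpodd : Odd p := (Nat.odd_mul.1 hodd).1
  have hp2 : p ≠ 2 := by rintro rfl; exact absurd hpodd (by decide)
  have hcop : p.Coprime (4 * k) := by
    refine Nat.Coprime.mul_right ?_ (Nat.squarefree_mul_iff.1 hsq).1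
    exact (Nat.Coprime.pow_right 2 (Nat.coprime_two_right.2 hpodd) :)
  obtain ⟨r, hr⟩ := quadraticChar_exists_neg_one (F := ZMod p) (by rwa [ZMod.ringChar_zmod_n])
  obtain ⟨a, ha1, ha2⟩ := Nat.chineseRemainder hcop r.val 1
  refine ⟨a, by exact_mod_cast (Int.natCast_modEq_iff.2 ha2), ?_⟩
  rw [jacobiSym.mul_right' _ hp.ne_zero hk.ne', ← jacobiSym.legendreSym.to_jacobiSym]
  have h1 : jacobiSym a k = 1 := by
    have h : (a : ℤ) % k = 1 % k := by
      have := Int.natCast_modEq_iff.2 (ha2.of_dvd (dvd_mul_left k 4))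
      exact_mod_cast this
    rw [jacobiSym.mod_left' h, jacobiSym.one_left]
  have h2 : ((a : ℤ) : ZMod p) = r := by
    have := (ZMod.natCast_eq_natCast_iff _ _ _).2 ha1
    simpa using this
  rw [h1, mul_one, legendreSym, h2, hr]

/-- For odd squarefree `m > 1`, the Jacobi symbol modulo `m` is a primitive quadratic character. -/
theorem exists_primitive_quadratic_jacobiSym {m : ℕ} (hm : 1 < m) (hodd : Odd m)
    (hsq : Squarefree m) :
    ∃ χ : DirichletCharacter ℝ m, χ.IsPrimitive ∧ MulChar.IsQuadratic χ ∧ χ ≠ 1 ∧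
      ∀ a : ℤ, χ (a : ZMod m) = jacobiSym a m := by
  have : NeZero m := ⟨by omega⟩
  let φ : ℤ →* ℤ :=
    { toFun := fun a => jacobiSym a m
      map_one' := jacobiSym.one_left m
      map_mul' := fun a b => jacobiSym.mul_left a b m }
  refine exists_primitive_quadratic_of_periodic hm φ (fun a b h => jacobiSym.mod_left' h)
    (fun a => jacobiSym.trichotomy a m) (fun a h => ?_) fun p hp hpm => ?_
  · exact jacobiSym.eq_zero_iff_not_coprime.2 (by rwa [Ne, ← Int.isCoprime_iff_gcd_eq_one])
  · obtain ⟨a, ha, hJ⟩ := exists_jacobiSym_eq_neg_one hodd hsq hp hpm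
    exact ⟨a, ha.of_dvd (by exact_mod_cast dvd_mul_left _ _), hJ⟩

/-- For odd squarefree `m`, the product of `χ₄` and the Jacobi symbol modulo `m` is a primitive
quadratic character modulo `4 * m`. -/
theorem exists_primitive_quadratic_χ₄_mul_jacobiSym {m : ℕ} (hodd : Odd m)
    (hsq : Squarefree m) :
    ∃ χ : DirichletCharacter ℝ (4 * m), χ.IsPrimitive ∧ MulChar.IsQuadratic χ ∧ χ ≠ 1 ∧
      ∀ a : ℤ, χ (a : ZMod (4 * m)) = (ZMod.χ₄ a * jacobiSym a m : ℤ) := by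
  have hm : 0 < m := hodd.pos
  have : NeZero m := ⟨hm.ne'⟩
  let φ : ℤ →* ℤ :=
    { toFun := fun a => ZMod.χ₄ a * jacobiSym a m
      map_one' := by simp
      map_mul' := fun a b => by
        rw [jacobiSym.mul_left, Int.cast_mul, map_mul, mul_mul_mul_comm] }
  have hχ₄ {a b : ℤ} (h : a ≡ b [ZMOD 4]) : ZMod.χ₄ a = ZMod.χ₄ b := by
    rw [(ZMod.intCast_eq_intCast_iff a b 4).2 h]
  refine exists_primitive_quadratic_of_periodic (by omega) φ (fun a b h => ?_)
    (fun a => ?_) (fun a h => ?_) fun p hp hpm => ?_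
  · have h4 : a ≡ b [ZMOD 4] := h.of_dvd (by push_cast; exact dvd_mul_right _ _)
    have hm : a ≡ b [ZMOD m] := h.of_dvd (by push_cast; exact dvd_mul_left _ _)
    change ZMod.χ₄ a * jacobiSym a m = ZMod.χ₄ b * jacobiSym b m
    rw [hχ₄ h4, jacobiSym.mod_left' hm]
  · change ZMod.χ₄ a * jacobiSym a m = 0 ∨ ZMod.χ₄ a * jacobiSym a m = 1 ∨
      ZMod.χ₄ a * jacobiSym a m = -1
    rcases ZMod.isQuadratic_χ₄ a with h | h | h <;>
      rcases jacobiSym.trichotomy a m with h' | h' | h' <;> simp [h, h']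
  · change ZMod.χ₄ a * jacobiSym a m = 0
    rw [mul_eq_zero]
    by_contra! hne
    apply h
    push_cast
    refine IsCoprime.mul_right ?_ ?_
    · by_contra h4
      refine hne.1 (ZMod.χ₄.map_nonunit fun hu => h4 ?_)
      exact_mod_cast ((ZMod.coe_int_isUnit_iff_isCoprime a 4).1 hu).symm
    · rw [Int.isCoprime_iff_gcd_eq_one]
      by_contra h'
      exact hne.2 (jacobiSym.eq_zero_iff_not_coprime.2 h')
  · by_cases hp2 : p = 2
    · subst hp2
      obtain ⟨a, ha1, ha2⟩ := Nat.chineseRemainder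
        ((Nat.Coprime.pow_left 2 (Nat.coprime_two_left.2 hodd) :) : Nat.Coprime 4 m) 3 1
      have ha1' : a % 4 = 3 := ha1
      refine ⟨a, ?_, ?_⟩
      · rw [show 4 * m / 2 = 2 * m by omega]
        have : a ≡ 1 [MOD 2 * m] := by
          refine (Nat.modEq_and_modEq_iff_modEq_mul (Nat.coprime_two_left.2 hodd)).1 ⟨?_, ha2⟩
          change a % 2 = 1 % 2
          omega
        exact_mod_cast Int.natCast_modEq_iff.2 this
      · change ZMod.χ₄ (a : ℤ) * jacobiSym a m = -1
        have h1 : jacobiSym a m = 1 := by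
          rw [jacobiSym.mod_left' (a₂ := 1) (by exact_mod_cast ha2), jacobiSym.one_left]
        rw [h1, ZMod.χ₄_int_three_mod_four (by omega)]
        norm_num
    · have hpm' : p ∣ m := by
        refine Nat.Coprime.dvd_of_dvd_mul_left ?_ hpm
        exact (Nat.Coprime.pow_right 2 ((Nat.coprime_primes hp Nat.prime_two).2 hp2) :)
      obtain ⟨a, ha, hJ⟩ := exists_jacobiSym_eq_neg_one hodd hsq hp hpm'
      refine ⟨a, by rwa [Nat.mul_div_assoc _ hpm'], ?_⟩
      have h4 : a ≡ 1 [ZMOD 4] := ha.of_dvd (by push_cast; exact dvd_mul_right _ _)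
      change ZMod.χ₄ a * jacobiSym a m = -1
      rw [hχ₄ h4, hJ]
      simp

/-- The residue symbols of all primes up to `N` modulo a large prime can be prescribed. -/
theorem exists_prime_jacobiSym_eq (N : ℕ) (ε : ℕ → ℤ) (hε : ∀ p, ε p = 1 ∨ ε p = -1) :
    ∃ l > N, l.Prime ∧ Odd l ∧ ∀ p : ℕ, p.Prime → p ≤ N → jacobiSym p l = ε p := by
  have hres (p : ℕ) : ∃ r : ℕ, p.Prime →
      if p = 2 then r % 4 = 1 ∧ ZMod.χ₈ r = ε 2 else jacobiSym r p = ε p := by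
    by_cases hp : p.Prime
    swap
    · exact ⟨0, fun h => absurd h hp⟩
    by_cases hp2 : p = 2
    · rcases hε 2 with h | h
      · exact ⟨1, fun _ => by rw [if_pos hp2, h]; decide⟩
      · exact ⟨5, fun _ => by rw [if_pos hp2, h]; decide⟩
    · have : Fact p.Prime := ⟨hp⟩
      rcases hε p with h | h
      · exact ⟨1, fun _ => by simp [hp2, h]⟩
      · obtain ⟨r, hr⟩ := quadraticChar_exists_neg_one (F := ZMod p)
          (by rwa [ZMod.ringChar_zmod_n])
        refine ⟨r.val, fun _ => ?_⟩
        rw [if_neg hp2, h, ← jacobiSym.legendreSym.to_jacobiSym, legendreSym]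
        simpa using hr
  choose r hr using hres
  let s : ℕ → ℕ := fun p => if p = 2 then 8 else p
  let t := {p ∈ Finset.range (N + 3) | p.Prime}
  have ht {p : ℕ} (h : p ∈ t) : p.Prime := (Finset.mem_filter.1 h).2
  have hs0 : ∀ p ∈ t, s p ≠ 0 := fun p hp => by
    have := (ht hp).pos
    grind
  have hs2 : s 2 = 2 ^ 3 := rfl
  have hs {p : ℕ} (h : p ≠ 2) : s p = p := if_neg h
  have hcop : Set.Pairwise (t : Set ℕ) (Function.onFun Nat.Coprime s) := by
    intro p hp p' hp' hne
    have h := (Nat.coprime_primes (ht hp) (ht hp')).2 hne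
    change (s p).Coprime (s p')
    by_cases h2 : p = 2
    · subst h2
      rw [hs2, hs hne.symm]
      exact h.pow_left 3
    · rw [hs h2]
      by_cases h2' : p' = 2
      · subst h2'
        rw [hs2]
        exact h.pow_right 3
      · rwa [hs h2']
  obtain ⟨k, hk⟩ := Nat.chineseRemainderOfFinset r s t hs0 hcop
  have hkcop : k.Coprime (∏ p ∈ t, s p) := by
    refine Nat.Coprime.prod_right fun p hp => ?_
    have h1 := hr p (ht hp)
    have h2 := hk p hp
    by_cases hp2 : p = 2
    · subst hp2
      rw [if_pos rfl] at h1
      rw [hs2] at h2 ⊢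
      refine Nat.Coprime.pow_right 3 (Nat.coprime_two_right.2 (Nat.odd_iff.2 ?_))
      have := h1.1
      change k % 8 = r 2 % 8 at h2
      omega
    · rw [if_neg hp2] at h1
      rw [hs hp2] at h2 ⊢
      rw [Nat.Coprime, h2.gcd_eq, ← Int.gcd_natCast_natCast]
      by_contra hg
      have : NeZero p := ⟨(ht hp).ne_zero⟩
      rw [jacobiSym.eq_zero_iff_not_coprime.2 hg] at h1
      rcases hε p with h | h <;> omega
  obtain ⟨l, hlN, hl, hlk⟩ :=
    Nat.forall_exists_prime_gt_and_modEq N (Finset.prod_ne_zero_iff.2 hs0) hkcop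
  have hlr {p : ℕ} (hp : p ∈ t) : l ≡ r p [MOD s p] :=
    (hlk.of_dvd (Finset.dvd_prod_of_mem s hp)).trans (hk p hp)
  have h2t : 2 ∈ t := by simp [t, Nat.prime_two]
  have hr2 := hr 2 Nat.prime_two
  rw [if_pos rfl] at hr2
  have hl8 : l % 8 = r 2 % 8 := hlr h2t
  have hl4 : l % 4 = 1 := by omega
  have hlodd : Odd l := Nat.odd_iff.2 (by omega)
  refine ⟨l, hlN, hl, hlodd, fun p hp hpN => ?_⟩
  have hpt : p ∈ t := by simp [t, hp]; omega
  by_cases hp2 : p = 2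
  · subst hp2
    rw [← hr2.2, Nat.cast_ofNat, jacobiSym.at_two hlodd,
      (ZMod.natCast_eq_natCast_iff l (r 2) 8).2 hl8]
  · have h1 := hr p hp
    rw [if_neg hp2] at h1
    have h2 := hlr hpt
    rw [hs hp2] at h2
    rw [jacobiSym.quadratic_reciprocity_one_mod_four' (hp.odd_of_ne_two hp2) hl4, ← h1]
    exact jacobiSym.mod_left' (by exact_mod_cast h2)

/-- Every completely multiplicative function with values in `{-1, 0, 1}` agrees up to `N` with
a primitive quadratic character. -/
theorem exists_primitive_quadratic_eq_on_le (N : ℕ) {f : ℕ → ℝ} (hf : IsComplMult f)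
    (hv : ∀ n : ℕ, 0 < n → f n = -1 ∨ f n = 0 ∨ f n = 1) :
    ∃ q : ℕ, 0 < q ∧ ∃ χ : DirichletCharacter ℝ q,
      χ.IsPrimitive ∧ MulChar.IsQuadratic χ ∧ χ ≠ 1 ∧
      ∀ n : ℕ, 0 < n → n ≤ N → χ (n : ZMod q) = f n := by
  classical
  obtain ⟨c, hc, hc2, hcp⟩ : ∃ c : ℤ → ℤ,
      (∀ m : ℕ, 1 < m → Odd m → Squarefree m → ∃ q : ℕ, 0 < q ∧ ∃ χ : DirichletCharacter ℝ q,
        χ.IsPrimitive ∧ MulChar.IsQuadratic χ ∧ χ ≠ 1 ∧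
          ∀ a : ℤ, χ (a : ZMod q) = (c a * jacobiSym a m : ℤ)) ∧
      (f 2 = 0 → c 2 = 0) ∧ (∀ p : ℕ, p.Prime → f p ≠ 0 → c p = 1 ∨ c p = -1) := by
    by_cases h2 : f 2 = 0
    · refine ⟨fun a => ZMod.χ₄ a, fun m hm ho hs => ⟨4 * m, by omega,
        exists_primitive_quadratic_χ₄_mul_jacobiSym ho hs⟩, fun _ => by decide, fun p hp hfp => ?_⟩
      have hp2 : p ≠ 2 := by rintro rfl; exact hfp h2
      have hpodd := Nat.odd_iff.1 (hp.odd_of_ne_two hp2)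
      obtain h | h : (p : ℤ) % 4 = 1 ∨ (p : ℤ) % 4 = 3 := by omega
      · exact Or.inl (ZMod.χ₄_int_one_mod_four h)
      · exact Or.inr (ZMod.χ₄_int_three_mod_four h)
    · refine ⟨fun _ => 1, fun m hm ho hs => ⟨m, by omega, ?_⟩, fun h => absurd h h2,
        fun _ _ _ => Or.inl rfl⟩
      simpa using exists_primitive_quadratic_jacobiSym hm ho hs
  let t := {p ∈ Finset.range (N + 1) | p.Prime ∧ p ≠ 2 ∧ f p = 0}
  have ht {p : ℕ} : p ∈ t ↔ p ≤ N ∧ p.Prime ∧ p ≠ 2 ∧ f p = 0 := by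
    simp [t]
  let M := ∏ p ∈ t, p
  have hM0 : M ≠ 0 := Finset.prod_ne_zero_iff.2 fun p hp => (ht.1 hp).2.1.ne_zero
  have : NeZero M := ⟨hM0⟩
  have hMsq : Squarefree M := by
    refine Finset.squarefree_prod_of_pairwise_isCoprime (fun p hp p' hp' hne => ?_)
      fun p hp => (ht.1 hp).2.1.prime.squarefree
    exact Nat.coprime_iff_isRelPrime.1
      ((Nat.coprime_primes (ht.1 hp).2.1 (ht.1 hp').2.1).2 hne)
  have hcopM {p : ℕ} (hp : p.Prime) (hpt : p ∉ t) : p.Coprime M := by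
    refine Nat.Coprime.prod_right fun p' hp' => ?_
    refine (Nat.coprime_primes hp (ht.1 hp').2.1).2 ?_
    rintro rfl
    exact hpt hp'
  have hModd : Odd M :=
    Nat.coprime_two_left.1 (hcopM Nat.prime_two fun h => (ht.1 h).2.2.1 rfl)
  let ε : ℕ → ℤ := fun p => if f p = (c p * jacobiSym p M : ℤ) then 1 else -1
  obtain ⟨l, hlN, hl, hlodd, hlε⟩ := exists_prime_jacobiSym_eq N ε fun p => by
    simp only [ε]; split_ifs <;> simp
  have hlM : l.Coprime M := hcopM hl fun h => by have := (ht.1 h).1; omega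
  obtain ⟨q, hq, χ, h1, h2, h3, hχ⟩ := hc (M * l)
    (lt_of_lt_of_le hl.one_lt (Nat.le_mul_of_pos_left l (Nat.pos_of_ne_zero hM0)))
    (hModd.mul hlodd) ((Nat.squarefree_mul hlM.symm).2 ⟨hMsq, hl.prime.squarefree⟩)
  refine ⟨q, hq, χ, h1, h2, h3, fun n hn hnN =>
    eq_of_eq_on_primes (f := fun n : ℕ => χ (n : ZMod q)) (by simp) hf.1
      (fun m n _ _ => by simp) hf.2 (fun p hp hpN => ?_) hn hnN⟩
  have hχp := hχ p
  rw [Int.cast_natCast, jacobiSym.mul_right' _ hM0 hl.ne_zero, hlε p hp hpN, ← mul_assoc] at hχp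
  change χ (p : ZMod q) = f p
  rw [hχp]
  by_cases hfp : f p = 0
  · rw [hfp]
    by_cases hp2 : p = 2
    · subst hp2
      simp [hc2 hfp]
    · have : jacobiSym p M = 0 := by
        rw [jacobiSym.eq_zero_iff_not_coprime, Int.gcd_natCast_natCast,
          Nat.gcd_eq_left (Finset.dvd_prod_of_mem (fun p => p) (ht.2 ⟨hpN, hp, hp2, hfp⟩))]
        exact hp.one_lt.ne'
      simp [this]
  · have hJ : jacobiSym p M = 1 ∨ jacobiSym p M = -1 := by
      apply jacobiSym.eq_one_or_neg_one
      rw [Int.gcd_natCast_natCast]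
      exact hcopM hp fun h => hfp (ht.1 h).2.2.2
    have hg : c p * jacobiSym p M = 1 ∨ c p * jacobiSym p M = -1 := by
      rcases hcp p hp hfp with h | h <;> rcases hJ with h' | h' <;> simp [h, h']
    simp only [ε]
    rcases hg with h | h <;> rcases hv p hp.pos with h' | h' | h' <;>
      first
      | exact absurd h' hfp
      | (rw [h, h']; norm_num)


/-- every completely multiplicative `f` with values in `{-1, 0, 1}` agrees
up to `x` with some primitive quadratic Dirichlet character; consequently the minimum of
`∑_{n ≤ x} χ(n)/n` over primitive quadratic characters `χ` equals
`δ₀(x) = min_f ∑_{n ≤ x} f(n)/n`. -/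
theorem quadratic_character_realization (x : ℝ) (hx : 1 ≤ x) :
    (∀ f : ℕ → ℝ, IsComplMult f →
      (∀ n : ℕ, 0 < n → f n = -1 ∨ f n = 0 ∨ f n = 1) →
      ∃ q : ℕ, 0 < q ∧ ∃ χ : DirichletCharacter ℝ q,
        χ.IsPrimitive ∧ MulChar.IsQuadratic χ ∧ χ ≠ 1 ∧
        ∀ n : ℕ, 0 < n → (n : ℝ) ≤ x → χ (n : ZMod q) = f n)
    ∧ sInf {S : ℝ | ∃ q : ℕ, 0 < q ∧ ∃ χ : DirichletCharacter ℝ q,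
          χ.IsPrimitive ∧ MulChar.IsQuadratic χ ∧ χ ≠ 1 ∧
          S = ∑ n ∈ Finset.Icc 1 ⌊x⌋₊, χ (n : ZMod q) / n}
      = sInf {S : ℝ | ∃ f : ℕ → ℝ, IsComplMult f ∧
          (∀ n : ℕ, 0 < n → f n = -1 ∨ f n = 0 ∨ f n = 1) ∧
          S = ∑ n ∈ Finset.Icc 1 ⌊x⌋₊, f n / n} := by
  have key (f : ℕ → ℝ) (hf : IsComplMult f)
      (hv : ∀ n : ℕ, 0 < n → f n = -1 ∨ f n = 0 ∨ f n = 1) :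
      ∃ q : ℕ, 0 < q ∧ ∃ χ : DirichletCharacter ℝ q,
        χ.IsPrimitive ∧ MulChar.IsQuadratic χ ∧ χ ≠ 1 ∧
        ∀ n : ℕ, 0 < n → (n : ℝ) ≤ x → χ (n : ZMod q) = f n := by
    obtain ⟨q, hq, χ, h1, h2, h3, h⟩ := exists_primitive_quadratic_eq_on_le ⌊x⌋₊ hf hv
    exact ⟨q, hq, χ, h1, h2, h3, fun n hn hnx => h n hn (Nat.le_floor hnx)⟩
  refine ⟨key, congrArg sInf (Set.ext fun S => ⟨?_, ?_⟩)⟩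
  · rintro ⟨q, -, χ, -, hquad, -, rfl⟩
    refine ⟨fun n => χ (n : ZMod q), ⟨by simp, fun m n _ _ => by simp⟩, fun n _ => ?_, rfl⟩
    have := hquad (n : ZMod q)
    tauto
  · rintro ⟨f, hf, hv, rfl⟩
    obtain ⟨q, hq, χ, h1, h2, h3, h⟩ := key f hf hv
    refine ⟨q, hq, χ, h1, h2, h3, Finset.sum_congr rfl fun n hn => ?_⟩
    rw [Finset.mem_Icc] at hn
    rw [h n hn.1 ((Nat.le_floor_iff (by linarith)).1 hn.2)]
end
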